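/- arXiv:2605.16700 — 4 statements merged into one kernel-verified Lean document; each statement's English description precedes it below -/
import Mathlib

section
/- Let Ω ⊂ ℝ² be a compact convex set with nonempty interior and let w : Ω × Ω → [0,1] be a measurable symmetric function. Then Cr_Ω(w) ≥ (8/(9π²)) · e_Ω(w)³. -/
open MeasureTheory Filter Real Set
open scoped ENNReal Topology

noncomputable section

abbrev Pl := ℝ × ℝ

/-- Two straight segments cross if their relative interiors (open segments) meet. -/
def PCross (x₁ x₂ x₃ x₄ : Pl) : Prop :=
  (openSegment ℝ x₁ x₂ ∩ openSegment ℝ x₃ x₄).Nonempty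

/-- The uniform probability measure on `Ω` (normalized Lebesgue measure). -/
def unifOn (Ω : Set Pl) : Measure Pl := (volume Ω)⁻¹ • (volume.restrict Ω)

/-- Edge density `e_Ω(w)`. -/
def ePl (Ω : Set Pl) (w : Pl → Pl → ℝ) : ℝ≥0∞ :=
  ∫⁻ y, ∫⁻ z, ENNReal.ofReal (w y z) ∂(unifOn Ω) ∂(unifOn Ω)

open Classical in
/-- Indicator of the planar crossing event. -/
def pCrossInd (x₁ x₂ x₃ x₄ : Pl) : ℝ≥0∞ := if PCross x₁ x₂ x₃ x₄ then 1 else 0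

/-- Crossing functional `Cr_Ω(w)`. -/
def crPl (Ω : Set Pl) (w : Pl → Pl → ℝ) : ℝ≥0∞ :=
  ∫⁻ x₁, ∫⁻ x₂, ∫⁻ x₃, ∫⁻ x₄,
    ENNReal.ofReal (w x₁ x₂) * ENNReal.ofReal (w x₃ x₄) * pCrossInd x₁ x₂ x₃ x₄
      ∂(unifOn Ω) ∂(unifOn Ω) ∂(unifOn Ω) ∂(unifOn Ω)

/-- Wirtinger's inequality for antiperiodic functions. -/
theorem wirtinger_antiperiodic {z z' : ℝ → ℂ} (hz : ∀ x, HasDerivAt z (z' x) x)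
    (hz' : Continuous z') (hanti : ∀ x, z (x + π) = -z x) :
    ∫ x in (0 : ℝ)..(2 * π), ‖z x‖ ^ 2 ≤ ∫ x in (0 : ℝ)..(2 * π), ‖z' x‖ ^ 2 := by
  have hlt : (0 : ℝ) < 2 * π := by positivity
  have hzc : Continuous z := continuous_iff_continuousAt.2 fun x => (hz x).continuousAt
  have hmem : ∀ g : ℝ → ℂ, Continuous g → MemLp g 2 (volume.restrict (Ioc 0 (2 * π))) := by
    intro g hg
    obtain ⟨C, hC⟩ := (isCompact_Icc (a := (0 : ℝ)) (b := 2 * π)).exists_bound_of_continuousOn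
      hg.continuousOn
    refine MemLp.of_bound hg.aestronglyMeasurable C ?_
    filter_upwards [ae_restrict_mem measurableSet_Ioc] with x hx
    exact hC x (Ioc_subset_Icc_self hx)
  have hs := hasSum_sq_fourierCoeffOn hlt (hmem z hzc)
  have hs' := hasSum_sq_fourierCoeffOn hlt (hmem z' hz')
  have hper : z (2 * π) = z 0 := by
    have h1 := hanti π
    have h2 := hanti 0
    rw [zero_add] at h2
    rw [two_mul, h1, h2, neg_neg]
  have hle : ∀ n : ℤ, ‖fourierCoeffOn hlt z n‖ ^ 2 ≤ ‖fourierCoeffOn hlt z' n‖ ^ 2 := by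
    intro n
    rcases eq_or_ne n 0 with rfl | hn
    · have h0 : ∫ x in (0 : ℝ)..(2 * π), z x = 0 := by
        rw [← intervalIntegral.integral_add_adjacent_intervals (b := π)
          (hzc.intervalIntegrable _ _) (hzc.intervalIntegrable _ _)]
        have : ∫ x in π..(2 * π), z x = ∫ x in (0 : ℝ)..π, z (x + π) := by
          rw [intervalIntegral.integral_comp_add_right]
          simp [two_mul]
        rw [this]
        simp [hanti]
      have : fourierCoeffOn hlt z 0 = 0 := by
        rw [fourierCoeffOn_eq_integral]
        simp [h0]
      rw [this]
      simp
    · have h := fourierCoeffOn_of_hasDerivAt hlt hn (fun x _ => hz x) (hz'.intervalIntegrable _ _)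
      rw [hper] at h
      have h2 : ‖fourierCoeffOn hlt z n‖ = ‖fourierCoeffOn hlt z' n‖ / |(n : ℝ)| := by
        rw [h]
        simp only [sub_self, mul_zero, zero_sub, norm_mul, norm_neg, norm_div, norm_one,
          Complex.norm_I, Complex.norm_intCast]
        have hn' : |(n : ℝ)| ≠ 0 := by simpa using hn
        have : ‖(π : ℂ)‖ = π := by simp [abs_of_pos pi_pos]
        simp [abs_of_pos pi_pos]
        field_simp
      rw [h2]
      have : (1 : ℝ) ≤ |(n : ℝ)| := by exact_mod_cast Int.one_le_abs hn
      gcongr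
      exact div_le_self (norm_nonneg _) this
  have := hasSum_le hle hs hs'
  simp only [smul_eq_mul, sub_zero] at this
  exact le_of_mul_le_mul_left this (inv_pos.2 hlt)

/-- The planar Blaschke–Santaló inequality for origin-symmetric bodies, in terms of a positive
`π`-periodic function `H`. -/
theorem santalo_periodic {H G : ℝ → ℝ} (hH : ∀ x, HasDerivAt H (G x) x) (hG : Continuous G)
    (hpos : ∀ x, 0 < H x) (hper : ∀ x, H (x + π) = H x) :
    (∫ x in (0 : ℝ)..(2 * π), (H x ^ 2 - G x ^ 2)) * ∫ x in (0 : ℝ)..(2 * π), (H x ^ 2)⁻¹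
      ≤ (2 * π) ^ 2 := by
  have hHc : Continuous H := continuous_iff_continuousAt.2 fun x => (hH x).continuousAt
  have hKc : Continuous fun x => (H x ^ 2)⁻¹ := (hHc.pow 2).inv₀ fun x =>
    pow_ne_zero 2 (hpos x).ne'
  have hKint : ∀ a b, IntervalIntegrable (fun x => (H x ^ 2)⁻¹) volume a b :=
    fun a b => hKc.intervalIntegrable a b
  set S := ∫ x in (0 : ℝ)..(2 * π), (H x ^ 2)⁻¹ with hS
  have hhalf : ∀ x, ∫ y in x..(x + π), (H y ^ 2)⁻¹ = S / 2 := by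
    have hp : Function.Periodic (fun x => (H x ^ 2)⁻¹) π := fun x => by simp [hper]
    intro x
    rw [hp.intervalIntegral_add_eq x 0, zero_add, hS,
      ← intervalIntegral.integral_add_adjacent_intervals (hKint 0 π) (hKint π (2 * π)), two_mul π,
      hp.intervalIntegral_add_eq π 0, zero_add]
    ring
  have hSpos : 0 < S := by
    refine intervalIntegral.intervalIntegral_pos_of_pos (hKint _ _) (fun x => ?_) (by positivity)
    have := hpos x
    positivity
  set c := 2 * π / S with hc
  let τ : ℝ → ℝ := fun x => c * ∫ y in (0 : ℝ)..x, (H y ^ 2)⁻¹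
  have hτ : ∀ x, HasDerivAt τ (c * (H x ^ 2)⁻¹) x := fun x =>
    (intervalIntegral.integral_hasDerivAt_right (hKint 0 x)
      (hKc.stronglyMeasurableAtFilter _ _) hKc.continuousAt).const_mul c
  have hτper : ∀ x, τ (x + π) = τ x + π := by
    intro x
    simp only [τ]
    rw [← intervalIntegral.integral_add_adjacent_intervals (hKint 0 x) (hKint x (x + π)), hhalf,
      hc]
    field_simp
  have hτc : Continuous τ := continuous_iff_continuousAt.2 fun x => (hτ x).continuousAt
  let z : ℝ → ℂ := fun x => (H x : ℂ) * Complex.exp (τ x * Complex.I)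
  let z' : ℝ → ℂ := fun x =>
    ((G x : ℂ) + (c * (H x)⁻¹ : ℝ) * Complex.I) * Complex.exp (τ x * Complex.I)
  have hz : ∀ x, HasDerivAt z (z' x) x := by
    intro x
    have h1 := (hH x).ofReal_comp
    have h2 := (((hτ x).ofReal_comp).mul_const Complex.I).cexp
    refine (h1.mul h2).congr_deriv ?_
    have : (H x : ℂ) ≠ 0 := by exact_mod_cast (hpos x).ne'
    simp only [z']
    push_cast
    field_simp
  have hHinv : Continuous fun x => (H x)⁻¹ := hHc.inv₀ fun x => (hpos x).ne'
  have hz'c : Continuous z' := by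
    simp only [z']
    fun_prop
  have hanti : ∀ x, z (x + π) = -z x := by
    intro x
    simp only [z, hper, hτper]
    push_cast
    rw [add_mul, Complex.exp_add, Complex.exp_pi_mul_I]
    ring
  have hw := wirtinger_antiperiodic hz hz'c hanti
  have hn : ∀ x, ‖z x‖ ^ 2 = H x ^ 2 := by
    intro x
    simp [z, Complex.norm_exp_ofReal_mul_I]
  have hn' : ∀ x, ‖z' x‖ ^ 2 = G x ^ 2 + c ^ 2 * (H x ^ 2)⁻¹ := by
    intro x
    simp only [z', norm_mul, Complex.norm_exp_ofReal_mul_I, mul_one]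
    rw [← Complex.normSq_eq_norm_sq, Complex.normSq_add_mul_I]
    ring
  simp only [hn, hn'] at hw
  have hG2 : Continuous fun x => G x ^ 2 := hG.pow 2
  have hH2 : Continuous fun x => H x ^ 2 := hHc.pow 2
  rw [intervalIntegral.integral_add (hG2.intervalIntegrable _ _) ((hKint _ _).const_mul _),
    intervalIntegral.integral_const_mul, ← hS] at hw
  rw [intervalIntegral.integral_sub (hH2.intervalIntegrable _ _) (hG2.intervalIntegrable _ _)]
  have hfin : c ^ 2 * S * S = (2 * π) ^ 2 := by
    rw [hc]; field_simp
  nlinarith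

/-- The determinant of two plane vectors. -/
def crossDet (u v : Pl) : ℝ := u.1 * v.2 - u.2 * v.1

/-- The determinant of the unit vector with angle `θ` and the vector `u`. -/
def dirDet (θ : ℝ) (u : Pl) : ℝ := cos θ * u.2 - sin θ * u.1

/-- The inner product of the unit vector with angle `θ` and the vector `u`. -/
def dirDot (θ : ℝ) (u : Pl) : ℝ := cos θ * u.1 + sin θ * u.2

/-- Minus the derivative of `|dirDet θ u|` in `θ`, where it exists. -/
def dirSlope (θ : ℝ) (u : Pl) : ℝ := dirDet θ u * dirDot θ u / |dirDet θ u|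

@[fun_prop]
theorem Continuous.dirDet {α : Type*} [TopologicalSpace α] {f : α → ℝ} {g : α → Pl}
    (hf : Continuous f) (hg : Continuous g) : Continuous fun x => dirDet (f x) (g x) := by
  unfold _root_.dirDet
  fun_prop

@[fun_prop]
theorem Continuous.dirDot {α : Type*} [TopologicalSpace α] {f : α → ℝ} {g : α → Pl}
    (hf : Continuous f) (hg : Continuous g) : Continuous fun x => dirDot (f x) (g x) := by
  unfold _root_.dirDot
  fun_prop

@[fun_prop]
theorem Measurable.dirDet {α : Type*} [MeasurableSpace α] {f : α → ℝ} {g : α → Pl}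
    (hf : Measurable f) (hg : Measurable g) : Measurable fun x => dirDet (f x) (g x) := by
  unfold _root_.dirDet
  fun_prop

@[fun_prop]
theorem Measurable.dirDot {α : Type*} [MeasurableSpace α] {f : α → ℝ} {g : α → Pl}
    (hf : Measurable f) (hg : Measurable g) : Measurable fun x => dirDot (f x) (g x) := by
  unfold _root_.dirDot
  fun_prop

@[fun_prop]
theorem Measurable.dirSlope {α : Type*} [MeasurableSpace α] {f : α → ℝ} {g : α → Pl}
    (hf : Measurable f) (hg : Measurable g) : Measurable fun x => dirSlope (f x) (g x) := by
  unfold _root_.dirSlope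
  have h := hf.dirDet hg
  exact (h.mul (hf.dirDot hg)).div h.abs

theorem abs_dirDet_le (θ : ℝ) (u : Pl) : |dirDet θ u| ≤ 2 * ‖u‖ := by
  have h1 : |u.1| ≤ ‖u‖ := norm_fst_le u
  have h2 : |u.2| ≤ ‖u‖ := norm_snd_le u
  calc |dirDet θ u| ≤ |cos θ * u.2| + |sin θ * u.1| := abs_sub _ _
    _ = |cos θ| * |u.2| + |sin θ| * |u.1| := by rw [abs_mul, abs_mul]
    _ ≤ 1 * ‖u‖ + 1 * ‖u‖ := by
      gcongr
      exacts [abs_cos_le_one θ, abs_sin_le_one θ]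
    _ = 2 * ‖u‖ := by ring

theorem abs_dirDot_le (θ : ℝ) (u : Pl) : |dirDot θ u| ≤ 2 * ‖u‖ := by
  have h1 : |u.1| ≤ ‖u‖ := norm_fst_le u
  have h2 : |u.2| ≤ ‖u‖ := norm_snd_le u
  calc |dirDot θ u| ≤ |cos θ * u.1| + |sin θ * u.2| := abs_add_le _ _
    _ = |cos θ| * |u.1| + |sin θ| * |u.2| := by rw [abs_mul, abs_mul]
    _ ≤ 1 * ‖u‖ + 1 * ‖u‖ := by
      gcongr
      exacts [abs_cos_le_one θ, abs_sin_le_one θ]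
    _ = 2 * ‖u‖ := by ring

theorem abs_dirSlope_le (θ : ℝ) (u : Pl) : |dirSlope θ u| ≤ 2 * ‖u‖ := by
  refine le_trans ?_ (abs_dirDot_le θ u)
  unfold dirSlope
  rcases eq_or_ne (dirDet θ u) 0 with h | h
  · simp [h]
  · rw [abs_div, abs_mul, abs_abs, mul_div_cancel_left₀ _ (abs_ne_zero.2 h)]

theorem dirDet_add_pi (θ : ℝ) (u : Pl) : dirDet (θ + π) u = -dirDet θ u := by
  simp only [dirDet, cos_add_pi, sin_add_pi]
  ring

theorem dirDot_add_pi (θ : ℝ) (u : Pl) : dirDot (θ + π) u = -dirDot θ u := by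
  simp only [dirDot, cos_add_pi, sin_add_pi]
  ring

theorem dirSlope_add_pi (θ : ℝ) (u : Pl) : dirSlope (θ + π) u = dirSlope θ u := by
  simp only [dirSlope, dirDet_add_pi, dirDot_add_pi, abs_neg, neg_mul_neg]

theorem hasDerivAt_dirDet (θ : ℝ) (u : Pl) :
    HasDerivAt (fun θ => dirDet θ u) (-dirDot θ u) θ := by
  refine (((hasDerivAt_cos θ).mul_const u.2).sub ((hasDerivAt_sin θ).mul_const u.1)).congr_deriv ?_
  simp only [dirDot]
  ring

theorem hasDerivAt_abs_dirDet {θ : ℝ} {u : Pl} (h : dirDet θ u ≠ 0) :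
    HasDerivAt (fun θ => |dirDet θ u|) (-dirSlope θ u) θ := by
  refine ((hasDerivAt_abs h).comp θ (hasDerivAt_dirDet θ u)).congr_deriv ?_
  unfold dirSlope
  rcases h.lt_or_gt with h' | h'
  · rw [sign_neg h', abs_of_neg h']
    simp only [SignType.coe_neg_one]
    field_simp
  · rw [sign_pos h', abs_of_pos h']
    simp only [SignType.coe_one]
    field_simp

theorem exists_polar (u : Pl) : ∃ r α : ℝ, 0 ≤ r ∧ u = (r * cos α, r * sin α) := by
  refine ⟨‖(⟨u.1, u.2⟩ : ℂ)‖, Complex.arg ⟨u.1, u.2⟩, norm_nonneg _, ?_⟩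
  rw [Complex.norm_mul_cos_arg, Complex.norm_mul_sin_arg]

theorem dirDet_polar (θ r α : ℝ) : dirDet θ (r * cos α, r * sin α) = -(r * sin (θ - α)) := by
  simp only [dirDet, sin_sub]
  ring

theorem dirDot_polar (θ r α : ℝ) : dirDot θ (r * cos α, r * sin α) = r * cos (θ - α) := by
  simp only [dirDot, cos_sub]
  ring

theorem countable_dirDet_eq_zero {u : Pl} (hu : u ≠ 0) : {θ | dirDet θ u = 0}.Countable := by
  obtain ⟨r, α, -, rfl⟩ := exists_polar u
  have hr : r ≠ 0 := by
    rintro rfl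
    simp at hu
  refine (countable_range fun n : ℤ => n * π + α).mono fun θ hθ => ?_
  rw [mem_ofPred_eq, dirDet_polar, neg_eq_zero, mul_eq_zero, or_iff_right hr,
    sin_eq_zero_iff] at hθ
  obtain ⟨n, hn⟩ := hθ
  exact ⟨n, by simp [hn]⟩

theorem intervalIntegrable_dirKernel (u v : Pl) (a b : ℝ) :
    IntervalIntegrable (fun θ => |dirDet θ u| * |dirDet θ v| - dirSlope θ u * dirSlope θ v)
      volume a b := by
  have hd : ∀ u, Continuous fun θ => dirDet θ u := by fun_prop
  have hs : ∀ u, Measurable fun θ => dirSlope θ u := by fun_prop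
  refine (((hd u).abs.mul (hd v).abs).intervalIntegrable a b).sub ?_
  rw [intervalIntegrable_iff]
  refine Measure.integrableOn_of_bounded (M := (2 * ‖u‖) * (2 * ‖v‖)) (by simp)
    ((hs u).mul (hs v)).aestronglyMeasurable (Eventually.of_forall fun θ => ?_)
  rw [norm_mul]
  gcongr
  exacts [abs_dirSlope_le θ u, abs_dirSlope_le θ v]

theorem integral_dirKernel (u v : Pl) :
    ∫ θ in (0 : ℝ)..(2 * π), (|dirDet θ u| * |dirDet θ v| - dirSlope θ u * dirSlope θ v) =
      4 * |crossDet u v| := by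
  set K : ℝ → ℝ := fun θ => |dirDet θ u| * |dirDet θ v| - dirSlope θ u * dirSlope θ v with hK
  rcases eq_or_ne u 0 with rfl | hu
  · simp [hK, dirDet, dirSlope, crossDet]
  obtain ⟨ρ, β, hρ, rfl⟩ := exists_polar v
  have hper : Function.Periodic K π := fun θ => by
    simp only [hK, dirDet_add_pi, dirSlope_add_pi, abs_neg]
  have hint : ∀ a b, IntervalIntegrable K volume a b := intervalIntegrable_dirKernel u _
  have h2 : ∫ θ in (0 : ℝ)..(2 * π), K θ = 2 * ∫ θ in β..(β + π), K θ := by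
    rw [← intervalIntegral.integral_add_adjacent_intervals (hint 0 π) (hint π (2 * π)), two_mul π,
      hper.intervalIntegral_add_eq π β]
    nth_rw 1 [← zero_add π]
    rw [hper.intervalIntegral_add_eq 0 β]
    ring
  have hcont : Continuous fun θ => -(|dirDet θ u| * (ρ * cos (θ - β))) := by
    fun_prop
  have hP : ∀ θ ∈ Ioo β (β + π) \ {θ | dirDet θ u = 0},
      HasDerivAt (fun θ => -(|dirDet θ u| * (ρ * cos (θ - β)))) (K θ) θ := by
    rintro θ ⟨⟨h1, h2⟩, h3⟩
    have hsin : 0 < sin (θ - β) := sin_pos_of_pos_of_lt_pi (by linarith) (by linarith)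
    have hc : HasDerivAt (fun θ => ρ * cos (θ - β)) (ρ * -sin (θ - β)) θ := by
      simpa using (((hasDerivAt_id θ).sub_const β).cos).const_mul ρ
    refine ((hasDerivAt_abs_dirDet h3).mul hc).neg.congr_deriv ?_
    have hsl : dirSlope θ (ρ * cos β, ρ * sin β) = -(ρ * cos (θ - β)) := by
      rw [dirSlope, dirDet_polar, dirDot_polar, abs_neg, abs_of_nonneg (by positivity)]
      rcases hρ.eq_or_lt with rfl | hρ
      · simp
      · field_simp
    simp only [hK]
    rw [hsl, dirDet_polar, abs_neg, abs_of_nonneg (by positivity : 0 ≤ ρ * sin (θ - β))]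
    ring
  rw [h2, integral_eq_of_hasDerivAt_off_countable_of_le _ K (by linarith [pi_pos])
    (countable_dirDet_eq_zero hu) hcont.continuousOn hP (hint _ _)]
  have hcr : |crossDet u (ρ * cos β, ρ * sin β)| = ρ * |dirDet β u| := by
    rw [← abs_of_nonneg hρ, ← abs_mul, ← abs_neg, abs_of_nonneg hρ]
    congr 1
    simp only [crossDet, dirDet]
    ring
  rw [hcr, dirDet_add_pi, abs_neg]
  simp only [add_sub_cancel_left, sub_self, cos_pi, cos_zero]
  ring

theorem volume_dirDet_eq_zero (θ : ℝ) : volume {u : Pl | dirDet θ u = 0} = 0 := by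
  let L : Pl →ₗ[ℝ] ℝ := cos θ • LinearMap.snd ℝ ℝ ℝ - sin θ • LinearMap.fst ℝ ℝ ℝ
  have hL : ∀ u, L u = dirDet θ u := fun u => by simp [L, dirDet]
  have hset : {u : Pl | dirDet θ u = 0} = (LinearMap.ker L : Set Pl) := by
    ext u
    simp [hL]
  rw [hset]
  refine Measure.addHaar_submodule _ _ fun h => ?_
  have h1 : ((-sin θ, cos θ) : Pl) ∈ LinearMap.ker L := h ▸ Submodule.mem_top
  rw [LinearMap.mem_ker, hL] at h1
  simp only [dirDet] at h1
  nlinarith [sin_sq_add_cos_sq θ]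

section Zonoid

variable (μ : Measure Pl)

/-- Half the support function (rotated by a right angle) of the zonoid generated by `μ`. -/
def zonoidSupport (θ : ℝ) : ℝ := ∫ u, |dirDet θ u| ∂μ

/-- The derivative of `zonoidSupport`. -/
def zonoidSlope (θ : ℝ) : ℝ := ∫ u, -dirSlope θ u ∂μ

variable {μ}

theorem integrable_abs_dirDet (hμ : Integrable (fun u : Pl => ‖u‖) μ) (θ : ℝ) :
    Integrable (fun u => |dirDet θ u|) μ := by
  refine (hμ.const_mul 2).mono'
    (by fun_prop : Continuous fun u => |dirDet θ u|).aestronglyMeasurable ?_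
  exact Eventually.of_forall fun u => by simpa using abs_dirDet_le θ u

theorem integrable_dirSlope (hμ : Integrable (fun u : Pl => ‖u‖) μ) (θ : ℝ) :
    Integrable (fun u => dirSlope θ u) μ := by
  refine (hμ.const_mul 2).mono'
    (by fun_prop : Measurable fun u => dirSlope θ u).aestronglyMeasurable ?_
  exact Eventually.of_forall fun u => abs_dirSlope_le θ u

theorem ae_dirDet_ne_zero (hvol : μ ≪ volume) (θ : ℝ) : ∀ᵐ u ∂μ, dirDet θ u ≠ 0 := by
  have := hvol (volume_dirDet_eq_zero θ)
  simpa [ae_iff] using this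

theorem hasDerivAt_zonoidSupport (hμ : Integrable (fun u : Pl => ‖u‖) μ) (hvol : μ ≪ volume)
    (θ : ℝ) : HasDerivAt (zonoidSupport μ) (zonoidSlope μ θ) θ := by
  refine (hasDerivAt_integral_of_dominated_loc_of_lip (bound := fun u => 2 * ‖u‖) univ_mem
    (Eventually.of_forall fun θ =>
      (by fun_prop : Continuous fun u => |dirDet θ u|).aestronglyMeasurable)
    (integrable_abs_dirDet hμ θ) (by fun_prop : Measurable fun u => -dirSlope θ u).aestronglyMeasurable
    (Eventually.of_forall fun u => ?_) (hμ.const_mul 2)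
    ((ae_dirDet_ne_zero hvol θ).mono fun u hu => hasDerivAt_abs_dirDet hu)).2
  refine LipschitzOnWith.of_dist_le_mul fun x _ y _ => ?_
  have h1 : |u.1| ≤ ‖u‖ := norm_fst_le u
  have h2 : |u.2| ≤ ‖u‖ := norm_snd_le u
  rw [Real.dist_eq, Real.dist_eq, Real.coe_nnabs, abs_of_nonneg (by positivity : 0 ≤ 2 * ‖u‖)]
  calc |(|dirDet x u| - |dirDet y u|)| ≤ |dirDet x u - dirDet y u| := abs_abs_sub_abs_le _ _
    _ = |(cos x - cos y) * u.2 - (sin x - sin y) * u.1| := by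
      simp only [dirDet]
      congr 1
      ring
    _ ≤ |cos x - cos y| * |u.2| + |sin x - sin y| * |u.1| := by
      rw [← abs_mul, ← abs_mul]
      exact abs_sub _ _
    _ ≤ |x - y| * ‖u‖ + |x - y| * ‖u‖ := by
      have hc := abs_cos_sub_cos_le x y
      have hs := abs_sin_sub_sin_le x y
      exact add_le_add (mul_le_mul hc h2 (abs_nonneg _) (abs_nonneg _))
        (mul_le_mul hs h1 (abs_nonneg _) (abs_nonneg _))
    _ = 2 * ‖u‖ * |x - y| := by ring

theorem continuous_zonoidSlope (hμ : Integrable (fun u : Pl => ‖u‖) μ) (hvol : μ ≪ volume) :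
    Continuous (zonoidSlope μ) := by
  refine continuous_iff_continuousAt.2 fun θ => ?_
  refine continuousAt_of_dominated (bound := fun u => 2 * ‖u‖)
    (Eventually.of_forall fun θ =>
      (by fun_prop : Measurable fun u => -dirSlope θ u).aestronglyMeasurable)
    (Eventually.of_forall fun θ => Eventually.of_forall fun u => ?_) (hμ.const_mul 2)
    ((ae_dirDet_ne_zero hvol θ).mono fun u hu => ?_)
  · simpa using abs_dirSlope_le θ u
  · have h1 : Continuous fun θ => dirDet θ u := by fun_prop
    have h2 : Continuous fun θ => dirDot θ u := by fun_prop
    exact ((h1.mul h2).continuousAt.div h1.abs.continuousAt (abs_ne_zero.2 hu)).neg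

theorem integral_zonoidSupport_sq_sub [IsFiniteMeasure μ]
    (hμ : Integrable (fun u : Pl => ‖u‖) μ) :
    ∫ θ in (0 : ℝ)..(2 * π), (zonoidSupport μ θ ^ 2 - zonoidSlope μ θ ^ 2) =
      4 * ∫ p, |crossDet p.1 p.2| ∂(μ.prod μ) := by
  let K : ℝ → Pl × Pl → ℝ := fun θ p =>
    |dirDet θ p.1| * |dirDet θ p.2| - dirSlope θ p.1 * dirSlope θ p.2
  have hK : ∀ θ, zonoidSupport μ θ ^ 2 - zonoidSlope μ θ ^ 2 = ∫ p, K θ p ∂(μ.prod μ) := by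
    intro θ
    have h1 := integrable_abs_dirDet hμ θ
    have h2 := integrable_dirSlope hμ θ
    simp only [K]
    rw [integral_sub (h1.mul_prod h1) (h2.mul_prod h2),
      integral_prod_mul (fun u => |dirDet θ u|) (fun u => |dirDet θ u|), integral_prod_mul,
      zonoidSupport, zonoidSlope, integral_neg]
    ring
  have hint : Integrable (Function.uncurry K)
      ((volume.restrict (Ioc 0 (2 * π))).prod (μ.prod μ)) := by
    have hb : Integrable (fun q : ℝ × (Pl × Pl) => 8 * (‖q.2.1‖ * ‖q.2.2‖))
        ((volume.restrict (Ioc 0 (2 * π))).prod (μ.prod μ)) :=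
      ((hμ.mul_prod hμ).const_mul 8).comp_snd _
    refine hb.mono' ?_ (Eventually.of_forall fun q => ?_)
    · simp only [K, Function.uncurry_def]
      have hd : Measurable fun q : ℝ × (Pl × Pl) => |dirDet q.1 q.2.1| * |dirDet q.1 q.2.2| :=
        (by fun_prop : Continuous _).measurable
      have hs : Measurable fun q : ℝ × (Pl × Pl) => dirSlope q.1 q.2.1 * dirSlope q.1 q.2.2 := by
        fun_prop
      exact (hd.sub hs).aestronglyMeasurable
    · obtain ⟨θ, u, v⟩ := q
      calc |(|dirDet θ u| * |dirDet θ v| - dirSlope θ u * dirSlope θ v)|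
          ≤ |(|dirDet θ u| * |dirDet θ v|)| + |dirSlope θ u * dirSlope θ v| := abs_sub _ _
        _ = |dirDet θ u| * |dirDet θ v| + |dirSlope θ u| * |dirSlope θ v| := by
          rw [abs_mul, abs_mul, abs_abs, abs_abs]
        _ ≤ (2 * ‖u‖) * (2 * ‖v‖) + (2 * ‖u‖) * (2 * ‖v‖) := by
          gcongr
          exacts [abs_dirDet_le θ u, abs_dirDet_le θ v, abs_dirSlope_le θ u, abs_dirSlope_le θ v]
        _ = 8 * (‖u‖ * ‖v‖) := by ring
  simp only [hK]
  rw [intervalIntegral.integral_of_le (by positivity), integral_integral_swap hint,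
    ← integral_const_mul]
  refine integral_congr_ae (Eventually.of_forall fun p => ?_)
  simp only [← integral_dirKernel, K]
  rw [intervalIntegral.integral_of_le (by positivity)]

end Zonoid

theorem lintegral_radial {l h : ℝ} (hl : 0 < l) (hh : 0 < h) :
    ∫⁻ r in Ioi (0 : ℝ), ENNReal.ofReal r * ENNReal.ofReal (l - r * h) =
      ENNReal.ofReal (l ^ 3 / 6 * (h ^ 2)⁻¹) := by
  have hpos : 0 < l / h := by positivity
  rw [← Ioc_union_Ioi_eq_Ioi hpos.le, lintegral_union measurableSet_Ioi
    Ioc_disjoint_Ioi_same]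
  have h2 : ∫⁻ r in Ioi (l / h), ENNReal.ofReal r * ENNReal.ofReal (l - r * h) = 0 := by
    rw [setLIntegral_congr_fun (g := fun _ => 0) measurableSet_Ioi, lintegral_zero]
    intro r hr
    have : l ≤ r * h := (div_le_iff₀ hh).1 (le_of_lt hr)
    simp [ENNReal.ofReal_of_nonpos (sub_nonpos.2 this)]
  have h1 : ∫⁻ r in Ioc 0 (l / h), ENNReal.ofReal r * ENNReal.ofReal (l - r * h) =
      ∫⁻ r in Ioc 0 (l / h), ENNReal.ofReal (r * (l - r * h)) :=
    setLIntegral_congr_fun measurableSet_Ioc fun r hr => (ENNReal.ofReal_mul hr.1.le).symm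
  have hc : Continuous fun r : ℝ => r * (l - r * h) := by fun_prop
  rw [h1, h2, add_zero, ← ofReal_integral_eq_lintegral_ofReal
    (hc.integrableOn_Ioc) ?_, ← intervalIntegral.integral_of_le hpos.le]
  · congr 1
    have hd : ∀ r ∈ uIcc 0 (l / h),
        HasDerivAt (fun r : ℝ => l * r ^ 2 / 2 - h * r ^ 3 / 3) (r * (l - r * h)) r := by
      intro r _
      refine ((((hasDerivAt_pow 2 r).const_mul l).div_const 2).sub
        (((hasDerivAt_pow 3 r).const_mul h).div_const 3)).congr_deriv ?_
      push_cast
      ring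
    rw [intervalIntegral.integral_eq_sub_of_hasDerivAt hd (hc.intervalIntegrable _ _)]
    field_simp
    ring
  · filter_upwards [ae_restrict_mem measurableSet_Ioc] with r hr
    have : r * h ≤ l := (le_div_iff₀ hh).1 hr.2
    exact mul_nonneg hr.1.le (sub_nonneg.2 this)

theorem integrable_crossDet {μ : Measure Pl} [SFinite μ] (hμ : Integrable (fun u : Pl => ‖u‖) μ) :
    Integrable (fun p : Pl × Pl => |crossDet p.1 p.2|) (μ.prod μ) := by
  refine ((hμ.mul_prod hμ).const_mul 2).mono' ?_ (Eventually.of_forall fun p => ?_)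
  · have : Continuous fun p : Pl × Pl => |crossDet p.1 p.2| := by
      unfold crossDet
      fun_prop
    exact this.aestronglyMeasurable
  · have h1 : |p.1.1| ≤ ‖p.1‖ := norm_fst_le p.1
    have h2 : |p.1.2| ≤ ‖p.1‖ := norm_snd_le p.1
    have h3 : |p.2.1| ≤ ‖p.2‖ := norm_fst_le p.2
    have h4 : |p.2.2| ≤ ‖p.2‖ := norm_snd_le p.2
    rw [norm_abs_eq_norm, Real.norm_eq_abs]
    calc |crossDet p.1 p.2| ≤ |p.1.1 * p.2.2| + |p.1.2 * p.2.1| := abs_sub _ _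
      _ = |p.1.1| * |p.2.2| + |p.1.2| * |p.2.1| := by rw [abs_mul, abs_mul]
      _ ≤ ‖p.1‖ * ‖p.2‖ + ‖p.1‖ * ‖p.2‖ := by gcongr
      _ = 2 * (‖p.1‖ * ‖p.2‖) := by ring

/-- The integral of the truncated cone `(l - N)⁺`, where `N` is the norm with unit ball polar to
the zonoid of `μ`. -/
theorem lintegral_cone {μ : Measure Pl} [SFinite μ] (hc : Continuous (zonoidSupport μ))
    (hpos : ∀ θ, 0 < zonoidSupport μ θ) {l : ℝ} (hl : 0 < l) :
    ∫⁻ v : Pl, ENNReal.ofReal (l - ∫ u, |crossDet v u| ∂μ) =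
      ENNReal.ofReal (l ^ 3 / 6 * ∫ θ in (0 : ℝ)..(2 * π), (zonoidSupport μ θ ^ 2)⁻¹) := by
  have hinv : Continuous fun θ => (zonoidSupport μ θ ^ 2)⁻¹ :=
    (hc.pow 2).inv₀ fun θ => pow_ne_zero 2 (hpos θ).ne'
  have hpolar : ∀ p ∈ polarCoord.target,
      ENNReal.ofReal p.1 • ENNReal.ofReal (l - ∫ u, |crossDet (polarCoord.symm p) u| ∂μ) =
        ENNReal.ofReal p.1 * ENNReal.ofReal (l - p.1 * zonoidSupport μ p.2) := by
    rintro ⟨r, θ⟩ ⟨hr, -⟩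
    have hr : 0 < r := hr
    rw [smul_eq_mul, zonoidSupport, ← integral_const_mul]
    congr 4
    ext u
    rw [← abs_of_pos hr, ← abs_mul, abs_of_pos hr]
    congr 1
    simp only [crossDet, dirDet, polarCoord_symm_apply]
    ring
  have hper : Function.Periodic (fun θ => (zonoidSupport μ θ ^ 2)⁻¹) (2 * π) := fun θ => by
    simp only [zonoidSupport, two_mul, ← add_assoc, dirDet_add_pi, abs_neg]
  rw [← lintegral_comp_polarCoord_symm,
    setLIntegral_congr_fun polarCoord.open_target.measurableSet hpolar, polarCoord_target,
    Measure.volume_eq_prod, ← Measure.prod_restrict, lintegral_prod_symm _ ?_]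
  · simp only [lintegral_radial hl (hpos _)]
    rw [← ofReal_integral_eq_lintegral_ofReal, integral_const_mul, ← integral_Ioc_eq_integral_Ioo,
      ← intervalIntegral.integral_of_le (by linarith [pi_pos])]
    · have := hper.intervalIntegral_add_eq (-π) 0
      rw [show -π + 2 * π = π by ring, zero_add] at this
      rw [this]
    · exact ((hinv.const_mul _).integrableOn_Icc (a := -π) (b := π)).mono_set Ioo_subset_Icc_self
    · exact Eventually.of_forall fun θ => by positivity
  · have hm := hc.measurable
    fun_prop

/-- Busemann's random simplex inequality in the plane, for measures of density at most one. -/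
theorem busemann_planar {μ : Measure Pl} [IsFiniteMeasure μ]
    (hμ : Integrable (fun u : Pl => ‖u‖) μ) (hle : μ ≤ volume) :
    8 / (9 * π ^ 2) * μ.real univ ^ 3 ≤ ∫ p, |crossDet p.1 p.2| ∂(μ.prod μ) := by
  rcases eq_or_ne μ 0 with rfl | h0
  · simp
  have hac : μ ≪ volume := hle.absolutelyContinuous
  have hderiv := hasDerivAt_zonoidSupport hμ hac
  have hHc : Continuous (zonoidSupport μ) :=
    continuous_iff_continuousAt.2 fun θ => (hderiv θ).continuousAt
  have hpos : ∀ θ, 0 < zonoidSupport μ θ := by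
    intro θ
    refine (integral_pos_iff_support_of_nonneg (fun u => abs_nonneg _)
      (integrable_abs_dirDet hμ θ)).2 ?_
    rw [pos_iff_ne_zero]
    intro h
    refine h0 (ae_eq_bot.1 (eventually_false_iff_eq_bot.1 ?_))
    filter_upwards [ae_dirDet_ne_zero hac θ, measure_eq_zero_iff_ae_notMem.1 h] with u h1 h2
    exact h2 (by simpa using h1)
  have hsant := santalo_periodic hderiv (continuous_zonoidSlope hμ hac) hpos
    (fun θ => by simp only [zonoidSupport, dirDet_add_pi, abs_neg])
  rw [integral_zonoidSupport_sq_sub hμ] at hsant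
  have hcone := fun {l : ℝ} (hl : 0 < l) => lintegral_cone hHc hpos hl
  have hinv : Continuous fun θ => (zonoidSupport μ θ ^ 2)⁻¹ :=
    (hHc.pow 2).inv₀ fun θ => pow_ne_zero 2 (hpos θ).ne'
  set P := ∫ θ in (0 : ℝ)..(2 * π), (zonoidSupport μ θ ^ 2)⁻¹ with hP
  set I := ∫ p, |crossDet p.1 p.2| ∂(μ.prod μ) with hI
  set M := μ.real univ with hM
  have hPpos : 0 < P := by
    refine intervalIntegral.intervalIntegral_pos_of_pos (hinv.intervalIntegrable _ _)
      (fun θ => ?_) (by positivity)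
    have := hpos θ
    positivity
  have hMpos : 0 < M := by
    rw [hM, measureReal_def]
    exact ENNReal.toReal_pos (by simpa using h0) (measure_ne_top _ _)
  have hI0 : 0 ≤ I := integral_nonneg fun p => abs_nonneg _
  have hcr := integrable_crossDet hμ
  have hN : Integrable (fun v => ∫ u, |crossDet v u| ∂μ) μ := hcr.integral_prod_left
  have hbath : ∀ l : ℝ, 0 < l → l * M - I ≤ l ^ 3 / 6 * P := by
    intro l hl
    have hint : Integrable (fun v => l - ∫ u, |crossDet v u| ∂μ) μ := (integrable_const l).sub hN
    have hmax : Integrable (fun v => max (l - ∫ u, |crossDet v u| ∂μ) 0) μ := hint.pos_part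
    calc l * M - I = ∫ v, (l - ∫ u, |crossDet v u| ∂μ) ∂μ := by
          rw [integral_sub (integrable_const l) hN, integral_const, hI, integral_prod _ hcr,
            smul_eq_mul, mul_comm]
      _ ≤ ∫ v, max (l - ∫ u, |crossDet v u| ∂μ) 0 ∂μ :=
          integral_mono hint hmax fun v => le_max_left _ _
      _ = (∫⁻ v, ENNReal.ofReal (l - ∫ u, |crossDet v u| ∂μ) ∂μ).toReal := by
          rw [integral_eq_lintegral_of_nonneg_ae (f := fun v => max (l - ∫ u, |crossDet v u| ∂μ) 0)
            (Eventually.of_forall fun v => le_max_right _ _)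
            hmax.aestronglyMeasurable]
          simp
      _ ≤ (ENNReal.ofReal (l ^ 3 / 6 * P)).toReal := by
          refine ENNReal.toReal_mono ENNReal.ofReal_ne_top ?_
          rw [← hcone hl]
          exact lintegral_mono' hle le_rfl
      _ = l ^ 3 / 6 * P := ENNReal.toReal_ofReal (by positivity)
  -- the optimal choice is `l ^ 2 = 2 * M / P`
  set l := √(2 * M / P) with hl
  have hlpos : 0 < l := sqrt_pos.2 (by positivity)
  have hl2 : l ^ 2 * P = 2 * M := by
    rw [hl, sq_sqrt (by positivity)]
    field_simp
  have hb := hbath l hlpos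
  have h1 : 2 / 3 * (l * M) ≤ I := by
    have : l ^ 3 / 6 * P = l * M / 3 := by
      calc l ^ 3 / 6 * P = l * (l ^ 2 * P) / 6 := by ring
        _ = l * M / 3 := by rw [hl2]; ring
    linarith
  have h2 : (2 / 3 * (l * M)) ^ 2 ≤ I ^ 2 := pow_le_pow_left₀ (by positivity) h1 2
  have h3 : 8 / 9 * M ^ 3 ≤ I * π ^ 2 := by
    have h4 : 8 / 9 * M ^ 3 ≤ I * (I * P) := by
      calc 8 / 9 * M ^ 3 = 4 / 9 * M ^ 2 * (2 * M) := by ring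
        _ = (2 / 3 * (l * M)) ^ 2 * P := by rw [← hl2]; ring
        _ ≤ I ^ 2 * P := by gcongr
        _ = I * (I * P) := by ring
    exact h4.trans (mul_le_mul_of_nonneg_left (by nlinarith) hI0)
  rw [div_mul_eq_mul_div, div_le_iff₀ (by positivity)]
  linarith

@[fun_prop]
theorem Continuous.crossDet {α : Type*} [TopologicalSpace α] {f g : α → Pl}
    (hf : Continuous f) (hg : Continuous g) : Continuous fun x => crossDet (f x) (g x) := by
  unfold _root_.crossDet
  fun_prop

@[fun_prop]
theorem Measurable.crossDet {α : Type*} [MeasurableSpace α] {f g : α → Pl}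
    (hf : Measurable f) (hg : Measurable g) : Measurable fun x => crossDet (f x) (g x) := by
  unfold _root_.crossDet
  fun_prop

/-- Busemann's random simplex inequality in the plane, for densities with bounded support. -/
theorem busemann_planar_lintegral {F : Pl → ℝ≥0∞} (hF : Measurable F) (hF1 : ∀ v, F v ≤ 1)
    {R : ℝ} (hR : ∀ v, F v ≠ 0 → ‖v‖ ≤ R) :
    ENNReal.ofReal (8 / (9 * π ^ 2)) * (∫⁻ v, F v) ^ 3 ≤
      ∫⁻ v₁, ∫⁻ v₂, ENNReal.ofReal |crossDet v₁ v₂| * (F v₁ * F v₂) := by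
  set μ : Measure Pl := volume.withDensity F with hμdef
  have hmass : μ univ = ∫⁻ v, F v := by rw [hμdef, withDensity_apply _ .univ, setLIntegral_univ]
  have hfin : IsFiniteMeasure μ := by
    refine ⟨?_⟩
    rw [hmass]
    calc ∫⁻ v, F v ≤ ∫⁻ v, (Metric.closedBall (0 : Pl) R).indicator 1 v := by
          refine lintegral_mono fun v => ?_
          by_cases hv : F v = 0
          · simp [hv]
          · rw [indicator_of_mem (by simpa using hR v hv)]
            exact hF1 v
      _ = volume (Metric.closedBall (0 : Pl) R) :=
          lintegral_indicator_one Metric.isClosed_closedBall.measurableSet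
      _ < ∞ := (isCompact_closedBall 0 R).measure_lt_top
  have hle : μ ≤ volume := by
    calc μ ≤ volume.withDensity 1 := withDensity_mono (Eventually.of_forall hF1)
      _ = volume := withDensity_one
  have hint : Integrable (fun u : Pl => ‖u‖) μ := by
    refine Integrable.of_bound continuous_norm.aestronglyMeasurable R ?_
    rw [hμdef, ae_withDensity_iff hF]
    exact Eventually.of_forall fun v hv => by simpa using hR v hv
  have hb := ENNReal.ofReal_le_ofReal (busemann_planar hint hle)
  have hmeas : Measurable fun p : Pl × Pl => ENNReal.ofReal |crossDet p.1 p.2| := by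
    have : Continuous fun p : Pl × Pl => |crossDet p.1 p.2| := by fun_prop
    exact this.measurable.ennreal_ofReal
  rw [ENNReal.ofReal_mul (by positivity), ENNReal.ofReal_pow measureReal_nonneg,
    ofReal_measureReal, hmass, ofReal_integral_eq_lintegral_ofReal (integrable_crossDet hint)
    (Eventually.of_forall fun p => abs_nonneg _), lintegral_prod _ hmeas.aemeasurable] at hb
  refine hb.trans (le_of_eq ?_)
  have hm1 : Measurable fun v₁ => ∫⁻ v₂, ENNReal.ofReal |crossDet v₁ v₂| ∂μ :=
    hmeas.lintegral_prod_right'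
  rw [hμdef, lintegral_withDensity_eq_lintegral_mul _ hF hm1]
  refine lintegral_congr fun v₁ => ?_
  have hm2 : Measurable fun v₂ => ENNReal.ofReal |crossDet v₁ v₂| :=
    hmeas.comp measurable_prodMk_left
  rw [Pi.mul_apply, lintegral_withDensity_eq_lintegral_mul _ hF hm2,
    ← lintegral_const_mul _ (hF.mul hm2)]
  refine lintegral_congr fun v₂ => ?_
  rw [Pi.mul_apply]
  ring

/-- The triples `(x₃ - x₁, x₁ - x₂, x₃ - x₄)` for which the segments from `x₁` to `x₂` and from
`x₃` to `x₄` cross and are not parallel, in terms of Cramer's rule. -/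
def crossSet : Set (Pl × Pl × Pl) :=
  {p | crossDet p.2.1 p.2.2 ≠ 0 ∧ crossDet p.2.1 p.1 / crossDet p.2.1 p.2.2 ∈ Ioo (0 : ℝ) 1 ∧
    crossDet p.2.2 p.1 / crossDet p.2.1 p.2.2 ∈ Ioo (0 : ℝ) 1}

theorem measurableSet_crossSet : MeasurableSet crossSet := by
  have h12 : Measurable fun p : Pl × Pl × Pl => crossDet p.2.1 p.2.2 := by fun_prop
  have h10 : Measurable fun p : Pl × Pl × Pl => crossDet p.2.1 p.1 := by fun_prop
  have h20 : Measurable fun p : Pl × Pl × Pl => crossDet p.2.2 p.1 := by fun_prop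
  exact (h12 (measurableSet_singleton 0).compl).inter
    (((h10.div h12) measurableSet_Ioo).inter ((h20.div h12) measurableSet_Ioo))

theorem pCross_of_mem_crossSet {x₁ x₂ x₃ x₄ : Pl}
    (h : (x₃ - x₁, x₁ - x₂, x₃ - x₄) ∈ crossSet) : PCross x₁ x₂ x₃ x₄ := by
  obtain ⟨h0, ⟨hs0, hs1⟩, ⟨ht0, ht1⟩⟩ := h
  dsimp only at h0 hs0 hs1 ht0 ht1
  set D := crossDet (x₁ - x₂) (x₃ - x₄) with hD
  set s := crossDet (x₁ - x₂) (x₃ - x₁) / D with hs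
  set t := crossDet (x₃ - x₄) (x₃ - x₁) / D with ht
  have hs' : s * D = crossDet (x₁ - x₂) (x₃ - x₁) := div_mul_cancel₀ _ h0
  have ht' : t * D = crossDet (x₃ - x₄) (x₃ - x₁) := div_mul_cancel₀ _ h0
  refine ⟨(1 - t) • x₁ + t • x₂, ⟨1 - t, t, by linarith, ht0, by ring, rfl⟩,
    1 - s, s, by linarith, hs0, by ring, ?_⟩
  have key : ∀ a b : ℝ, D * a = D * b → a = b := fun a b => mul_left_cancel₀ h0
  simp only [crossDet, Prod.fst_sub, Prod.snd_sub] at hs' ht' hD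
  ext
  · apply key
    simp only [Prod.fst_add, Prod.smul_fst, smul_eq_mul]
    linear_combination (x₄.1 - x₃.1) * hs' + (x₁.1 - x₂.1) * ht' + (x₃.1 - x₁.1) * hD
  · apply key
    simp only [Prod.snd_add, Prod.smul_snd, smul_eq_mul]
    linear_combination (x₄.2 - x₃.2) * hs' + (x₁.2 - x₂.2) * ht' + (x₃.2 - x₁.2) * hD

/-- Integration over the displacements of two crossing segments with given directions. -/
theorem lintegral_crossSet (F : Pl → ℝ≥0∞) (v₁ v₂ : Pl) :
    ∫⁻ d, F d * crossSet.indicator 1 (d, v₁, v₂) =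
      ENNReal.ofReal |crossDet v₁ v₂| *
        ∫⁻ p in Ioo (0 : ℝ) 1 ×ˢ Ioo (0 : ℝ) 1, F (p.1 • v₂ - p.2 • v₁) := by
  rcases eq_or_ne (crossDet v₁ v₂) 0 with h0 | h0
  · have : ∀ d, (d, v₁, v₂) ∉ crossSet := fun d hd => hd.1 h0
    simp [h0, this]
  let L : (ℝ × ℝ) →L[ℝ] (ℝ × ℝ) := LinearMap.toContinuousLinearMap
    (Matrix.toLin (Module.Basis.finTwoProd ℝ) (Module.Basis.finTwoProd ℝ)
      !![v₂.1, -v₁.1; v₂.2, -v₁.2])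
  have hL : ∀ p, L p = p.1 • v₂ - p.2 • v₁ := by
    rintro ⟨s, t⟩
    ext <;> simp [L, Matrix.toLin_finTwoProd_apply] <;> ring
  have hdet : L.det = crossDet v₁ v₂ := by
    simp only [L, LinearMap.det_toContinuousLinearMap, LinearMap.det_toLin, Matrix.det_fin_two_of,
      crossDet]
    ring
  have hinv1 : ∀ p : ℝ × ℝ, crossDet v₁ (L p) / crossDet v₁ v₂ = p.1 := by
    intro p
    rw [div_eq_iff h0, hL]
    simp only [crossDet, Prod.fst_sub, Prod.snd_sub, Prod.smul_fst, Prod.smul_snd, smul_eq_mul]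
    ring
  have hinv2 : ∀ p : ℝ × ℝ, crossDet v₂ (L p) / crossDet v₁ v₂ = p.2 := by
    intro p
    rw [div_eq_iff h0, hL]
    simp only [crossDet, Prod.fst_sub, Prod.snd_sub, Prod.smul_fst, Prod.smul_snd, smul_eq_mul]
    ring
  have hright : ∀ d, L (crossDet v₁ d / crossDet v₁ v₂, crossDet v₂ d / crossDet v₁ v₂) = d := by
    intro d
    rw [hL]
    ext
    · simp only [Prod.fst_sub, Prod.smul_fst, smul_eq_mul]
      field_simp
      simp only [crossDet]
      ring
    · simp only [Prod.snd_sub, Prod.smul_snd, smul_eq_mul]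
      field_simp
      simp only [crossDet]
      ring
  have himage : {d | (d, v₁, v₂) ∈ crossSet} = L '' (Ioo (0 : ℝ) 1 ×ˢ Ioo (0 : ℝ) 1) := by
    ext d
    constructor
    · rintro ⟨-, h1, h2⟩
      exact ⟨_, ⟨h1, h2⟩, hright d⟩
    · rintro ⟨p, ⟨h1, h2⟩, rfl⟩
      refine ⟨h0, ?_, ?_⟩
      · dsimp only
        rwa [hinv1]
      · dsimp only
        rwa [hinv2]
  have hinj : InjOn L (Ioo (0 : ℝ) 1 ×ˢ Ioo (0 : ℝ) 1) := by
    intro p _ q _ h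
    ext
    · rw [← hinv1 p, h, hinv1]
    · rw [← hinv2 p, h, hinv2]
  have hmeas : MeasurableSet {d : Pl | (d, v₁, v₂) ∈ crossSet} :=
    measurableSet_crossSet.preimage (by fun_prop : Measurable fun d : Pl => (d, v₁, v₂))
  have hind : ∀ d, F d * crossSet.indicator 1 (d, v₁, v₂) =
      {d | (d, v₁, v₂) ∈ crossSet}.indicator F d := by
    intro d
    by_cases hd : (d, v₁, v₂) ∈ crossSet
    · rw [indicator_of_mem hd, indicator_of_mem (s := {d | (d, v₁, v₂) ∈ crossSet}) hd]
      simp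
    · rw [indicator_of_notMem hd, indicator_of_notMem (s := {d | (d, v₁, v₂) ∈ crossSet}) hd]
      simp
  simp only [hind]
  rw [lintegral_indicator hmeas, himage, lintegral_image_eq_lintegral_abs_det_fderiv_mul volume
    (measurableSet_Ioo.prod measurableSet_Ioo) (fun p _ => L.hasFDerivWithinAt) hinj, hdet,
    lintegral_const_mul' _ _ ENNReal.ofReal_ne_top]
  simp only [hL]

/-- The density at `v` of the chords with difference vector `v` that pass through `q`. -/
def chordDensity (W : Pl × Pl → ℝ≥0∞) (q v : Pl) : ℝ≥0∞ :=
  ∫⁻ t in Ioo (0 : ℝ) 1, W (q + t • v, q + t • v - v)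

theorem measurable_chordDensity {W : Pl × Pl → ℝ≥0∞} (hW : Measurable W) :
    Measurable fun p : Pl × Pl => chordDensity W p.1 p.2 := by
  have h : Measurable fun p : (Pl × Pl) × ℝ =>
      W (p.1.1 + p.2 • p.1.2, p.1.1 + p.2 • p.1.2 - p.1.2) := by fun_prop
  exact h.lintegral_prod_right'

/-- Averaging over the position of two crossing segments with given difference vectors. -/
theorem lintegral_lintegral_crossSet {W : Pl × Pl → ℝ≥0∞} (hW : Measurable W) (v₁ v₂ : Pl) :
    ∫⁻ x, ∫⁻ d, W (x, x - v₁) * W (x + d, x + d - v₂) * crossSet.indicator 1 (d, v₁, v₂) =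
      ∫⁻ q, ENNReal.ofReal |crossDet v₁ v₂| * (chordDensity W q v₁ * chordDensity W q v₂) := by
  simp only [lintegral_crossSet]
  rw [lintegral_const_mul' _ _ ENNReal.ofReal_ne_top,
    lintegral_const_mul' _ _ ENNReal.ofReal_ne_top]
  congr 1
  have h1 : Measurable fun z : Pl × ℝ × ℝ => W (z.1, z.1 - v₁) *
      W (z.1 + (z.2.1 • v₂ - z.2.2 • v₁), z.1 + (z.2.1 • v₂ - z.2.2 • v₁) - v₂) := by fun_prop
  rw [lintegral_lintegral_swap h1.aemeasurable]
  have h2 : ∀ p : ℝ × ℝ, ∫⁻ x, W (x, x - v₁) *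
      W (x + (p.1 • v₂ - p.2 • v₁), x + (p.1 • v₂ - p.2 • v₁) - v₂) =
      ∫⁻ q, W (q + p.2 • v₁, q + p.2 • v₁ - v₁) * W (q + p.1 • v₂, q + p.1 • v₂ - v₂) := by
    intro p
    rw [← lintegral_add_right_eq_self _ (p.2 • v₁)]
    refine lintegral_congr fun q => ?_
    rw [show q + p.2 • v₁ + (p.1 • v₂ - p.2 • v₁) = q + p.1 • v₂ by abel]
  simp only [h2]
  have h3 : Measurable fun z : (ℝ × ℝ) × Pl => W (z.2 + z.1.2 • v₁, z.2 + z.1.2 • v₁ - v₁) *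
      W (z.2 + z.1.1 • v₂, z.2 + z.1.1 • v₂ - v₂) := by fun_prop
  rw [lintegral_lintegral_swap h3.aemeasurable]
  refine lintegral_congr fun q => ?_
  have h4 : ∀ v : Pl, Measurable fun t : ℝ => W (q + t • v, q + t • v - v) := by
    intro v
    fun_prop
  rw [mul_comm (chordDensity W q v₁), chordDensity, chordDensity, Measure.volume_eq_prod,
    ← Measure.prod_restrict, ← lintegral_prod_mul (h4 v₂).aemeasurable (h4 v₁).aemeasurable]
  exact lintegral_congr fun p => mul_comm _ _

/-- The crossing functional as an average over crossing points. -/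
theorem lintegral_crossing_eq {W : Pl × Pl → ℝ≥0∞} (hW : Measurable W) :
    ∫⁻ x₁, ∫⁻ x₂, ∫⁻ x₃, ∫⁻ x₄,
        W (x₁, x₂) * W (x₃, x₄) * crossSet.indicator 1 (x₃ - x₁, x₁ - x₂, x₃ - x₄) =
      ∫⁻ q, ∫⁻ v₁, ∫⁻ v₂,
        ENNReal.ofReal |crossDet v₁ v₂| * (chordDensity W q v₁ * chordDensity W q v₂) := by
  have hK : Measurable (crossSet.indicator (1 : Pl × Pl × Pl → ℝ≥0∞)) :=
    measurable_one.indicator measurableSet_crossSet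
  have hsub : ∀ x₁ : Pl, ∫⁻ x₂, ∫⁻ x₃, ∫⁻ x₄,
        W (x₁, x₂) * W (x₃, x₄) * crossSet.indicator 1 (x₃ - x₁, x₁ - x₂, x₃ - x₄) =
      ∫⁻ v₁, ∫⁻ v₂, ∫⁻ d,
        W (x₁, x₁ - v₁) * W (x₁ + d, x₁ + d - v₂) * crossSet.indicator 1 (d, v₁, v₂) := by
    intro x₁
    rw [← lintegral_sub_left_eq_self _ x₁]
    refine lintegral_congr fun v₁ => ?_
    rw [← lintegral_add_left_eq_self _ x₁]
    have hm : Measurable fun z : Pl × Pl => W (x₁, x₁ - v₁) * W (x₁ + z.2, x₁ + z.2 - z.1) *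
        crossSet.indicator 1 (z.2, v₁, z.1) := by fun_prop
    refine Eq.trans ?_
      (lintegral_lintegral_swap (μ := volume) (ν := volume) hm.aemeasurable).symm
    refine lintegral_congr fun d => ?_
    rw [← lintegral_sub_left_eq_self _ (x₁ + d)]
    refine lintegral_congr fun v₂ => ?_
    simp only [add_sub_cancel_left, sub_sub_cancel]
  simp only [hsub]
  have hm1 : Measurable fun z : ((Pl × Pl) × Pl) × Pl =>
      W (z.1.1.1, z.1.1.1 - z.1.1.2) * W (z.1.1.1 + z.2, z.1.1.1 + z.2 - z.1.2) *
        crossSet.indicator 1 (z.2, z.1.1.2, z.1.2) := by fun_prop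
  have hm2 := (hm1.lintegral_prod_right' (ν := volume)).lintegral_prod_right' (ν := volume)
  rw [lintegral_lintegral_swap hm2.aemeasurable]
  have hswap : ∀ v₁ : Pl, ∫⁻ x₁, ∫⁻ v₂, ∫⁻ d,
        W (x₁, x₁ - v₁) * W (x₁ + d, x₁ + d - v₂) * crossSet.indicator 1 (d, v₁, v₂) =
      ∫⁻ q, ∫⁻ v₂, ENNReal.ofReal |crossDet v₁ v₂| *
        (chordDensity W q v₁ * chordDensity W q v₂) := by
    intro v₁
    have hm3 : Measurable fun z : (Pl × Pl) × Pl =>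
        W (z.1.1, z.1.1 - v₁) * W (z.1.1 + z.2, z.1.1 + z.2 - z.1.2) *
        crossSet.indicator 1 (z.2, v₁, z.1.2) := by fun_prop
    rw [lintegral_lintegral_swap hm3.lintegral_prod_right'.aemeasurable]
    simp only [lintegral_lintegral_crossSet hW]
    have hf := measurable_chordDensity hW
    have hm4 : Measurable fun z : Pl × Pl => ENNReal.ofReal |crossDet v₁ z.1| *
        (chordDensity W z.2 v₁ * chordDensity W z.2 z.1) := by
      have ha : Measurable fun z : Pl × Pl => chordDensity W z.2 v₁ :=
        hf.comp (measurable_snd.prodMk measurable_const)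
      have hb : Measurable fun z : Pl × Pl => chordDensity W z.2 z.1 :=
        hf.comp (measurable_snd.prodMk measurable_fst)
      have hc : Continuous fun z : Pl × Pl => |crossDet v₁ z.1| := by fun_prop
      exact hc.measurable.ennreal_ofReal.mul (ha.mul hb)
    rw [lintegral_lintegral_swap hm4.aemeasurable]
  simp only [hswap]
  have hf := measurable_chordDensity hW
  have hm5 : Measurable fun z : (Pl × Pl) × Pl => ENNReal.ofReal |crossDet z.1.1 z.2| *
      (chordDensity W z.1.2 z.1.1 * chordDensity W z.1.2 z.2) := by
    have ha : Measurable fun z : (Pl × Pl) × Pl => chordDensity W z.1.2 z.1.1 :=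
      hf.comp ((by fun_prop : Measurable fun z : (Pl × Pl) × Pl => (z.1.2, z.1.1)))
    have hb : Measurable fun z : (Pl × Pl) × Pl => chordDensity W z.1.2 z.2 :=
      hf.comp ((by fun_prop : Measurable fun z : (Pl × Pl) × Pl => (z.1.2, z.2)))
    have hc : Continuous fun z : (Pl × Pl) × Pl => |crossDet z.1.1 z.2| := by fun_prop
    exact hc.measurable.ennreal_ofReal.mul (ha.mul hb)
  rw [lintegral_lintegral_swap hm5.lintegral_prod_right'.aemeasurable]

/-- The total mass of the chord densities is the total mass of the edge weights. -/
theorem lintegral_chordDensity {W : Pl × Pl → ℝ≥0∞} (hW : Measurable W) :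
    ∫⁻ q, ∫⁻ v, chordDensity W q v = ∫⁻ x, ∫⁻ y, W (x, y) := by
  have hf := measurable_chordDensity hW
  rw [lintegral_lintegral_swap hf.aemeasurable]
  have hq : ∀ v : Pl, ∫⁻ q, chordDensity W q v = ∫⁻ x, W (x, x - v) := by
    intro v
    have hm : Measurable fun z : Pl × ℝ => W (z.1 + z.2 • v, z.1 + z.2 • v - v) := by fun_prop
    unfold chordDensity
    rw [lintegral_lintegral_swap hm.aemeasurable]
    have : ∀ t : ℝ, ∫⁻ q, W (q + t • v, q + t • v - v) = ∫⁻ x, W (x, x - v) := fun t =>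
      lintegral_add_right_eq_self (fun x => W (x, x - v)) (t • v)
    simp [this]
  simp only [hq]
  have hm : Measurable fun z : Pl × Pl => W (z.2, z.2 - z.1) := by fun_prop
  rw [lintegral_lintegral_swap hm.aemeasurable]
  refine lintegral_congr fun x => ?_
  exact lintegral_sub_left_eq_self (fun y => W (x, y)) x

theorem chordDensity_le_one {W : Pl × Pl → ℝ≥0∞} (hW : ∀ p, W p ≤ 1) (q v : Pl) :
    chordDensity W q v ≤ 1 := by
  calc chordDensity W q v ≤ ∫⁻ _ in Ioo (0 : ℝ) 1, 1 := lintegral_mono fun _ => hW _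
    _ = 1 := by simp

theorem exists_of_chordDensity_ne_zero {W : Pl × Pl → ℝ≥0∞} {q v : Pl}
    (h : chordDensity W q v ≠ 0) :
    ∃ t ∈ Ioo (0 : ℝ) 1, W (q + t • v, q + t • v - v) ≠ 0 := by
  contrapose! h
  exact setLIntegral_eq_zero measurableSet_Ioo h

/-- The cubic Jensen inequality for a function supported on a given set. -/
theorem lintegral_pow_three_le {Ω : Set Pl} {m : Pl → ℝ≥0∞} (hm : Measurable m)
    (hmΩ : Function.support m ⊆ Ω) :
    (∫⁻ q, m q) ^ 3 ≤ volume Ω ^ 2 * ∫⁻ q, m q ^ 3 := by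
  have hpq : Real.HolderConjugate 3 (3 / 2) := by
    rw [Real.holderConjugate_iff]
    norm_num
  have h := ENNReal.lintegral_mul_le_Lp_mul_Lq (volume.restrict Ω) hpq hm.aemeasurable
    (g := 1) aemeasurable_one
  simp only [mul_one, Pi.one_apply, ENNReal.one_rpow, lintegral_one, Measure.restrict_apply_univ,
    setLIntegral_eq_of_support_subset hmΩ] at h
  have h3 := pow_le_pow_left' h 3
  rw [mul_pow, ← ENNReal.rpow_mul_natCast, ← ENNReal.rpow_mul_natCast] at h3
  norm_num at h3
  rw [mul_comm]
  refine h3.trans ?_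
  exact mul_le_mul' (setLIntegral_le_lintegral _ _) le_rfl

/-- The crossing inequality without normalization. -/
theorem crossing_lower_bound {W : Pl × Pl → ℝ≥0∞} (hW : Measurable W) (hW1 : ∀ p, W p ≤ 1)
    {Ω : Set Pl} (hconv : Convex ℝ Ω) (hbdd : Bornology.IsBounded Ω)
    (hsupp : Function.support W ⊆ Ω ×ˢ Ω) :
    ENNReal.ofReal (8 / (9 * π ^ 2)) * (∫⁻ x, ∫⁻ y, W (x, y)) ^ 3 ≤
      volume Ω ^ 2 * ∫⁻ x₁, ∫⁻ x₂, ∫⁻ x₃, ∫⁻ x₄,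
        W (x₁, x₂) * W (x₃, x₄) * crossSet.indicator 1 (x₃ - x₁, x₁ - x₂, x₃ - x₄) := by
  have hf := measurable_chordDensity hW
  have hchord : ∀ q v, chordDensity W q v ≠ 0 → q ∈ Ω ∧ ‖v‖ ≤ Metric.diam Ω := by
    intro q v h
    obtain ⟨t, ht, hne⟩ := exists_of_chordDensity_ne_zero h
    obtain ⟨hx, hy⟩ := hsupp hne
    constructor
    · have := hconv hx hy (sub_nonneg.2 ht.2.le) ht.1.le (by ring)
      convert this using 1
      module
    · simpa [dist_eq_norm] using Metric.dist_le_diam_of_mem hbdd hx hy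
  have hmm : Measurable fun q => ∫⁻ v, chordDensity W q v := hf.lintegral_prod_right'
  have hms : (Function.support fun q => ∫⁻ v, chordDensity W q v) ⊆ Ω := by
    intro q hq
    by_contra hqΩ
    refine hq ?_
    have : ∀ v, chordDensity W q v = 0 := fun v => by
      by_contra hv
      exact hqΩ (hchord q v hv).1
    simp [this]
  rw [lintegral_crossing_eq hW, ← lintegral_chordDensity hW]
  calc ENNReal.ofReal (8 / (9 * π ^ 2)) * (∫⁻ q, ∫⁻ v, chordDensity W q v) ^ 3
      ≤ ENNReal.ofReal (8 / (9 * π ^ 2)) *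
          (volume Ω ^ 2 * ∫⁻ q, (∫⁻ v, chordDensity W q v) ^ 3) := by
        gcongr
        exact lintegral_pow_three_le hmm hms
    _ = volume Ω ^ 2 * ∫⁻ q, ENNReal.ofReal (8 / (9 * π ^ 2)) *
          (∫⁻ v, chordDensity W q v) ^ 3 := by
        rw [lintegral_const_mul' _ _ ENNReal.ofReal_ne_top, mul_left_comm]
    _ ≤ _ := by
        gcongr with q
        exact busemann_planar_lintegral (hf.comp measurable_prodMk_left)
          (chordDensity_le_one hW1 q) fun v hv => (hchord q v hv).2

theorem lintegral_unifOn (Ω : Set Pl) (f : Pl → ℝ≥0∞) :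
    ∫⁻ x, f x ∂(unifOn Ω) = (volume Ω)⁻¹ * ∫⁻ x in Ω, f x := by
  rw [unifOn, lintegral_smul_measure, smul_eq_mul]

theorem lintegral_le_setLIntegral {Ω : Set Pl} (hΩ : MeasurableSet Ω) {f g : Pl → ℝ≥0∞}
    (hf : ∀ x ∉ Ω, f x = 0) (hfg : ∀ x ∈ Ω, f x ≤ g x) : ∫⁻ x, f x ≤ ∫⁻ x in Ω, g x := by
  rw [← setLIntegral_eq_of_support_subset (s := Ω) (f := f)
    fun x hx => by_contra fun h => hx (hf x h)]
  exact setLIntegral_mono' hΩ hfg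

theorem setLIntegral_le_lintegral_of_le {Ω : Set Pl} (hΩ : MeasurableSet Ω) {f g : Pl → ℝ≥0∞}
    (hfg : ∀ x ∈ Ω, f x ≤ g x) : ∫⁻ x in Ω, f x ≤ ∫⁻ x, g x :=
  (setLIntegral_mono' hΩ hfg).trans (setLIntegral_le_lintegral _ _)

/-- **Continuous planar crossing inequality.**  Let `Ω ⊂ ℝ²` be compact and convex
with nonempty interior and let `w : Ω × Ω → [0,1]` be measurable and symmetric.
Then `Cr_Ω(w) ≥ (8/(9π²)) e_Ω(w)³`. -/
theorem continuous_planar_crossing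
    (Ω : Set Pl) (hΩc : IsCompact Ω) (hΩconv : Convex ℝ Ω)
    (hΩint : (interior Ω).Nonempty)
    (w : Pl → Pl → ℝ) (hmeas : Measurable (Function.uncurry w))
    (hsymm : ∀ x y, w x y = w y x)
    (hrange : ∀ x ∈ Ω, ∀ y ∈ Ω, w x y ∈ Set.Icc (0:ℝ) 1) :
    ENNReal.ofReal (8 / (9 * π ^ 2)) * (ePl Ω w) ^ 3 ≤ crPl Ω w := by
  have hΩm : MeasurableSet Ω := hΩc.isClosed.measurableSet
  have hA0 : volume Ω ≠ 0 := (Measure.measure_pos_of_nonempty_interior volume hΩint).ne'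
  have hA : volume Ω ≠ ∞ := hΩc.measure_lt_top.ne
  have hAi : (volume Ω)⁻¹ ≠ ∞ := ENNReal.inv_ne_top.2 hA0
  set W : Pl × Pl → ℝ≥0∞ :=
    (Ω ×ˢ Ω).indicator fun p => ENNReal.ofReal (Function.uncurry w p) with hWdef
  have hW : Measurable W := hmeas.ennreal_ofReal.indicator (hΩm.prod hΩm)
  have hWΩ : ∀ x ∈ Ω, ∀ y ∈ Ω, W (x, y) = ENNReal.ofReal (w x y) := fun x hx y hy =>
    indicator_of_mem (mk_mem_prod hx hy) _
  have hWl : ∀ x ∉ Ω, ∀ y, W (x, y) = 0 := fun x hx y =>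
    indicator_of_notMem (fun h => hx h.1) _
  have hWr : ∀ y ∉ Ω, ∀ x, W (x, y) = 0 := fun y hy x =>
    indicator_of_notMem (fun h => hy h.2) _
  have hW1 : ∀ p, W p ≤ 1 := fun p =>
    indicator_apply_le' (fun h => ENNReal.ofReal_le_one.2 (hrange _ h.1 _ h.2).2)
      fun _ => zero_le_one
  have hmain := crossing_lower_bound hW hW1 hΩconv hΩc.isBounded support_indicator_subset
  have he : ePl Ω w ≤ (volume Ω)⁻¹ ^ 2 * ∫⁻ x, ∫⁻ y, W (x, y) := by
    simp only [ePl, lintegral_unifOn, lintegral_const_mul' _ _ hAi]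
    rw [← mul_assoc, ← sq]
    refine mul_le_mul' le_rfl ?_
    refine setLIntegral_le_lintegral_of_le hΩm fun x hx => ?_
    exact setLIntegral_le_lintegral_of_le hΩm fun y hy => (hWΩ x hx y hy).ge
  have hcr : (volume Ω)⁻¹ ^ 4 * (∫⁻ x₁, ∫⁻ x₂, ∫⁻ x₃, ∫⁻ x₄,
      W (x₁, x₂) * W (x₃, x₄) * crossSet.indicator 1 (x₃ - x₁, x₁ - x₂, x₃ - x₄)) ≤
      crPl Ω w := by
    simp only [crPl, lintegral_unifOn, lintegral_const_mul' _ _ hAi]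
    rw [← mul_assoc, ← mul_assoc, ← mul_assoc, ← sq, ← pow_succ, ← pow_succ]
    refine mul_le_mul' le_rfl ?_
    refine lintegral_le_setLIntegral hΩm (fun x₁ h₁ => by simp [hWl x₁ h₁]) fun x₁ h₁ => ?_
    refine lintegral_le_setLIntegral hΩm (fun x₂ h₂ => by simp [hWr x₂ h₂]) fun x₂ h₂ => ?_
    refine lintegral_le_setLIntegral hΩm (fun x₃ h₃ => by simp [hWl x₃ h₃]) fun x₃ h₃ => ?_
    refine lintegral_le_setLIntegral hΩm (fun x₄ h₄ => by simp [hWr x₄ h₄]) fun x₄ h₄ => ?_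
    rw [hWΩ x₁ h₁ x₂ h₂, hWΩ x₃ h₃ x₄ h₄]
    gcongr
    refine indicator_apply_le' (fun h => ?_) fun _ => zero_le
    simp [pCrossInd, pCross_of_mem_crossSet h]
  calc ENNReal.ofReal (8 / (9 * π ^ 2)) * ePl Ω w ^ 3
      ≤ ENNReal.ofReal (8 / (9 * π ^ 2)) *
          ((volume Ω)⁻¹ ^ 2 * ∫⁻ x, ∫⁻ y, W (x, y)) ^ 3 := by gcongr
    _ = (volume Ω)⁻¹ ^ 6 *
          (ENNReal.ofReal (8 / (9 * π ^ 2)) * (∫⁻ x, ∫⁻ y, W (x, y)) ^ 3) := by ring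
    _ ≤ (volume Ω)⁻¹ ^ 6 * (volume Ω ^ 2 * ∫⁻ x₁, ∫⁻ x₂, ∫⁻ x₃, ∫⁻ x₄,
          W (x₁, x₂) * W (x₃, x₄) *
            crossSet.indicator 1 (x₃ - x₁, x₁ - x₂, x₃ - x₄)) := by gcongr
    _ = ((volume Ω)⁻¹ * volume Ω) ^ 2 * ((volume Ω)⁻¹ ^ 4 * ∫⁻ x₁, ∫⁻ x₂, ∫⁻ x₃, ∫⁻ x₄,
          W (x₁, x₂) * W (x₃, x₄) *
            crossSet.indicator 1 (x₃ - x₁, x₁ - x₂, x₃ - x₄)) := by ring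
    _ ≤ crPl Ω w := by
        rw [ENNReal.inv_mul_cancel hA0 hA, one_pow, one_mul]
        exact hcr
end
end

section
/- Let φ : [0, 1/(8π²)] → ℝ be defined by φ(α) = (sin τ(α) − τ(α)·cos τ(α))/(16π²), where τ(α) = arccos(1 − 16π²α) ∈ [0,π]. Then the function α ↦ φ(α)^{2/3} is convex on [0, 1/(8π²)]. -/
open Real Set

noncomputable section

/-- `τ(α) = arccos(1 − 16π²α) ∈ [0,π]`. -/
def tauOf (α : ℝ) : ℝ := Real.arccos (1 - 16 * π ^ 2 * α)

/-- The bathtub profile `φ(α) = (sin τ(α) − τ(α) cos τ(α))/(16π²)`. -/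
def phiProfile (α : ℝ) : ℝ :=
  (Real.sin (tauOf α) - tauOf α * Real.cos (tauOf α)) / (16 * π ^ 2)

theorem hasDerivAt_sin_sub_mul_cos (t : ℝ) :
    HasDerivAt (fun t => sin t - t * cos t) (t * sin t) t := by
  simpa using (hasDerivAt_sin t).fun_sub ((hasDerivAt_id' t).fun_mul (hasDerivAt_cos t))

theorem sin_sub_mul_cos_pos {t : ℝ} (h0 : 0 < t) (hpi : t ≤ π) : 0 < sin t - t * cos t := by
  have hmono : StrictMonoOn (fun t => sin t - t * cos t) (Icc 0 π) := by
    refine strictMonoOn_of_deriv_pos (convex_Icc _ _) (by fun_prop) fun x hx => ?_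
    rw [interior_Icc] at hx
    rw [(hasDerivAt_sin_sub_mul_cos x).deriv]
    exact mul_pos hx.1 (sin_pos_of_mem_Ioo hx)
  simpa using hmono (left_mem_Icc.2 pi_pos.le) ⟨h0.le, hpi⟩ h0

theorem sq_mul_sin_le_three_mul {t : ℝ} (h0 : 0 ≤ t) (hpi : t ≤ π) :
    t ^ 2 * sin t ≤ 3 * (sin t - t * cos t) := by
  have hmono : MonotoneOn (fun t => 3 * (sin t - t * cos t) - t ^ 2 * sin t) (Icc 0 π) := by
    refine monotoneOn_of_deriv_nonneg (convex_Icc _ _) (by fun_prop) (by fun_prop) fun x hx => ?_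
    rw [interior_Icc] at hx
    have h := ((hasDerivAt_sin_sub_mul_cos x).const_mul 3).sub
      ((hasDerivAt_pow 2 x).mul (hasDerivAt_sin x))
    have hd : deriv (fun t => 3 * (sin t - t * cos t) - t ^ 2 * sin t) x =
        x * (sin x - x * cos x) := by
      refine (HasDerivAt.deriv h).trans ?_
      simp
      ring
    rw [hd]
    exact mul_nonneg hx.1.le (sin_sub_mul_cos_pos hx.1 hx.2.le).le
  have h := hmono (left_mem_Icc.2 pi_pos.le) ⟨h0, hpi⟩ h0
  simp only [sin_zero, cos_zero] at h
  linarith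

theorem monotoneOn_cube_div_sin_sub_mul_cos :
    MonotoneOn (fun t => t ^ 3 / (sin t - t * cos t)) (Ioo 0 π) := by
  have hder : ∀ x ∈ Ioo 0 π, HasDerivAt (fun t => t ^ 3 / (sin t - t * cos t))
      ((3 * x ^ 2 * (sin x - x * cos x) - x ^ 3 * (x * sin x)) / (sin x - x * cos x) ^ 2) x := by
    intro x hx
    simpa using (hasDerivAt_pow 3 x).fun_div (hasDerivAt_sin_sub_mul_cos x)
      (sin_sub_mul_cos_pos hx.1 hx.2.le).ne'
  refine monotoneOn_of_deriv_nonneg (convex_Ioo _ _)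
    (fun x hx => (hder x hx).continuousAt.continuousWithinAt) ?_ ?_ <;> rw [interior_Ioo]
  · exact fun x hx => (hder x hx).differentiableAt.differentiableWithinAt
  · intro x hx
    rw [(hder x hx).deriv]
    refine div_nonneg ?_ (sq_nonneg _)
    have h := mul_le_mul_of_nonneg_left (sq_mul_sin_le_three_mul hx.1.le hx.2.le) (sq_nonneg x)
    linarith

theorem one_sub_mem_Ioo {α : ℝ} (hα : α ∈ Ioo 0 (1 / (8 * π ^ 2))) :
    1 - 16 * π ^ 2 * α ∈ Ioo (-1 : ℝ) 1 := by
  have hpi : 0 < π ^ 2 := by positivity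
  have h := (lt_div_iff₀ (by positivity)).1 hα.2
  constructor
  · linarith
  · have := mul_pos hpi hα.1
    linarith

theorem tauOf_mem_Ioo {α : ℝ} (hα : α ∈ Ioo 0 (1 / (8 * π ^ 2))) : tauOf α ∈ Ioo 0 π := by
  have h := one_sub_mem_Ioo hα
  refine ⟨arccos_pos.2 h.2, lt_of_le_of_ne (arccos_le_pi _) fun he => ?_⟩
  exact absurd (arccos_eq_pi.1 he) (not_le.2 h.1)

theorem monotone_tauOf : Monotone tauOf := by
  intro a b hab
  refine arccos_le_arccos ?_
  have := mul_le_mul_of_nonneg_left hab (by positivity : 0 ≤ 16 * π ^ 2)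
  linarith

theorem phiProfile_pos {α : ℝ} (hα : α ∈ Ioo 0 (1 / (8 * π ^ 2))) : 0 < phiProfile α :=
  have h := tauOf_mem_Ioo hα
  div_pos (sin_sub_mul_cos_pos h.1 h.2.le) (by positivity)

theorem hasDerivAt_phiProfile {α : ℝ} (hα : α ∈ Ioo 0 (1 / (8 * π ^ 2))) :
    HasDerivAt phiProfile (tauOf α) α := by
  have h := one_sub_mem_Ioo hα
  have hτ : HasDerivAt tauOf (16 * π ^ 2 / sin (tauOf α)) α := by
    have h1 : HasDerivAt (fun α => 1 - 16 * π ^ 2 * α) (-(16 * π ^ 2)) α := by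
      simpa using ((hasDerivAt_id α).const_mul (16 * π ^ 2)).const_sub 1
    refine ((hasDerivAt_arccos h.1.ne' h.2.ne).comp α h1).congr_deriv ?_
    rw [tauOf, sin_arccos]
    ring
  have hs := (sin_pos_of_mem_Ioo (tauOf_mem_Ioo hα)).ne'
  refine (((hasDerivAt_sin_sub_mul_cos (tauOf α)).comp α hτ).div_const (16 * π ^ 2)).congr_deriv ?_
  field_simp

theorem continuous_phiProfile : Continuous phiProfile := by
  unfold phiProfile tauOf
  fun_prop

theorem hasDerivAt_phiProfile_rpow {α : ℝ} (hα : α ∈ Ioo 0 (1 / (8 * π ^ 2))) :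
    HasDerivAt (fun α => phiProfile α ^ ((2 : ℝ) / 3))
      (2 / 3 * (tauOf α ^ 3 / phiProfile α) ^ ((1 : ℝ) / 3)) α := by
  have hφ := phiProfile_pos hα
  have hτ := (tauOf_mem_Ioo hα).1
  convert (hasDerivAt_phiProfile hα).rpow_const (p := 2 / 3) (Or.inl hφ.ne') using 1
  rw [div_rpow (by positivity) hφ.le, ← rpow_natCast, ← rpow_mul hτ.le,
    show (2 / 3 - 1 : ℝ) = -(1 / 3) by norm_num, rpow_neg hφ.le]
  norm_num
  ring

/-- **Convexity of the bathtub profile.**  The function `α ↦ φ(α)^{2/3}` is convex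
on `[0, 1/(8π²)]`. -/
theorem phiProfile_rpow_convex :
    ConvexOn ℝ (Set.Icc 0 (1 / (8 * π ^ 2)))
      (fun α => (phiProfile α) ^ ((2 : ℝ) / 3)) := by
  refine MonotoneOn.convexOn_of_deriv (convex_Icc _ _)
    (continuous_phiProfile.rpow_const fun _ => Or.inr (by norm_num)).continuousOn ?_ ?_ <;>
    rw [interior_Icc]
  · exact fun α hα => (hasDerivAt_phiProfile_rpow hα).differentiableAt.differentiableWithinAt
  · intro α hα β hβ hαβ
    rw [(hasDerivAt_phiProfile_rpow hα).deriv, (hasDerivAt_phiProfile_rpow hβ).deriv]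
    have hτ := (tauOf_mem_Ioo hα).1
    have hφ := phiProfile_pos hα
    have h := monotoneOn_cube_div_sin_sub_mul_cos (tauOf_mem_Ioo hα) (tauOf_mem_Ioo hβ)
      (monotone_tauOf hαβ)
    have hle : tauOf α ^ 3 / phiProfile α ≤ tauOf β ^ 3 / phiProfile β := by
      simp only [phiProfile, div_div_eq_mul_div, mul_div_right_comm]
      exact mul_le_mul_of_nonneg_right h (by positivity)
    gcongr
end
end

section
/- For every τ ∈ (0,π), one has 3·(1 − τ·(cos τ / sin τ)) − τ² ≥ 0; equivalently, 1 − τ·cot τ ≥ τ²/3. -/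
open Real

theorem mul_cos_le_sin {x : ℝ} (hx : x ∈ Set.Icc 0 π) : x * cos x ≤ sin x := by
  have hderiv (y : ℝ) : HasDerivAt (fun t => sin t - t * cos t) (y * sin y) y := by
    refine ((hasDerivAt_sin y).sub ((hasDerivAt_id' y).mul (hasDerivAt_cos y))).congr_deriv ?_
    ring
  have hmono : MonotoneOn (fun t => sin t - t * cos t) (Set.Icc 0 π) := by
    refine monotoneOn_of_hasDerivWithinAt_nonneg (convex_Icc 0 π) (by fun_prop)
      (fun y _ => (hderiv y).hasDerivWithinAt) fun y hy => ?_
    have hy' := interior_subset hy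
    exact mul_nonneg hy'.1 (sin_nonneg_of_mem_Icc hy')
  have h := hmono (Set.left_mem_Icc.2 pi_pos.le) hx hx.1
  simp only [sin_zero, zero_mul, sub_zero] at h
  linarith

theorem sq_mul_sin_le {x : ℝ} (hx : x ∈ Set.Icc 0 π) :
    x ^ 2 * sin x ≤ 3 * (sin x - x * cos x) := by
  have hderiv (y : ℝ) : HasDerivAt (fun t => 3 * (sin t - t * cos t) - t ^ 2 * sin t)
      (y * (sin y - y * cos y)) y := by
    refine ((((hasDerivAt_sin y).sub ((hasDerivAt_id' y).mul (hasDerivAt_cos y))).const_mul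
      3).sub ((hasDerivAt_pow 2 y).mul (hasDerivAt_sin y))).congr_deriv ?_
    norm_num
    ring
  have hmono : MonotoneOn (fun t => 3 * (sin t - t * cos t) - t ^ 2 * sin t)
      (Set.Icc 0 π) := by
    refine monotoneOn_of_hasDerivWithinAt_nonneg (convex_Icc 0 π) (by fun_prop)
      (fun y _ => (hderiv y).hasDerivWithinAt) fun y hy => ?_
    have hy' := interior_subset hy
    exact mul_nonneg hy'.1 (sub_nonneg.2 (mul_cos_le_sin hy'))
  have h := hmono (Set.left_mem_Icc.2 pi_pos.le) hx hx.1
  simp only [sin_zero, zero_mul, mul_zero, sub_zero] at h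
  linarith

/-- **A cotangent inequality.**  For every `τ ∈ (0,π)`,
`3(1 − τ (cos τ / sin τ)) − τ² ≥ 0`; equivalently `1 − τ cot τ ≥ τ²/3`. -/
theorem one_sub_mul_cot_ge (τ : ℝ) (hτ : τ ∈ Set.Ioo 0 π) :
    0 ≤ 3 * (1 - τ * (Real.cos τ / Real.sin τ)) - τ ^ 2 ∧
    τ ^ 2 / 3 ≤ 1 - τ * (Real.cos τ / Real.sin τ) := by
  have hs : 0 < sin τ := sin_pos_of_mem_Ioo hτ
  have h : τ ^ 2 ≤ 3 * (1 - τ * (cos τ / sin τ)) := by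
    calc τ ^ 2 ≤ 3 * (sin τ - τ * cos τ) / sin τ :=
          (le_div_iff₀ hs).2 (sq_mul_sin_le (Set.Ioo_subset_Icc_self hτ))
      _ = 3 * (1 - τ * (cos τ / sin τ)) := by field_simp
  constructor <;> linarith
end

section
/- For every measurable function f : [0,2π) → [0,∞), one has ∫₀^{2π}∫₀^{2π} f(θ)·f(φ)·|sin(θ−φ)| dθ dφ ≥ (1/π²)·(∫₀^{2π} f(θ)^{2/3} dθ)³, where both sides may equal +∞ and the inequality is understood in [0,∞]. -/
open MeasureTheory Real Set
open scoped ENNReal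

lemma continuousAt_sq_mul_cot {e : ℝ → ℝ} {e' t : ℝ} (he : HasDerivAt e e' t) (het : e t = 0) :
    ContinuousAt (fun x ↦ e x ^ 2 * (cos (x - t) / sin (x - t))) t := by
  have hsin : HasDerivAt (fun x ↦ sin (x - t)) 1 t := by
    simpa using ((hasDerivAt_id t).sub_const t).sin
  have h1 := hasDerivAt_iff_tendsto_slope.1 he
  have h2 := hasDerivAt_iff_tendsto_slope.1 hsin
  have h3 := h1.div h2 one_ne_zero
  have h4 : Filter.Tendsto (fun x ↦ e x * cos (x - t)) (nhdsWithin t {t}ᶜ) (nhds 0) := by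
    have : ContinuousAt (fun x ↦ e x * cos (x - t)) t :=
      he.continuousAt.mul (by fun_prop)
    have h5 := this.tendsto.mono_left (nhdsWithin_le_nhds (s := {t}ᶜ))
    simpa [het] using h5
  rw [continuousAt_iff_punctured_nhds]
  have h5 := h4.mul h3
  simp only [sub_self, sin_zero, div_zero, mul_zero, zero_mul] at h5 ⊢
  refine h5.congr' ?_
  filter_upwards [self_mem_nhdsWithin] with x hx
  have hx' : x - t ≠ 0 := sub_ne_zero.2 hx
  simp only [Pi.div_apply, slope_def_field, het, sub_self, sin_zero, sub_zero]
  rw [div_div_div_cancel_right₀ hx']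
  ring

/-- Jacobi's form of the second variation, for the positive solution `sin (x - t) / h`. -/
lemma integral_curvature_mul_sq_le {h h1 g e e1 : ℝ → ℝ} {t : ℝ} (ht : t ∈ Ioo 0 π)
    (hg : Continuous g) (hh : ∀ x, HasDerivAt h (h1 x) x)
    (hh1 : ∀ x, HasDerivAt h1 (2 * g x - h x) x) (he : ∀ x, HasDerivAt e (e1 x) x)
    (he1 : Continuous e1) (het : e t = 0) (hper : e π ^ 2 = e 0 ^ 2) (hhper : h π = h 0)
    (hh1per : h1 π = h1 0) :
    ∫ x in 0..π, 2 * g x * h x * e x ^ 2 ≤ ∫ x in 0..π, h x ^ 2 * e1 x ^ 2 := by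
  have ch : Continuous h := continuous_iff_continuousAt.2 fun x ↦ (hh x).continuousAt
  have ch1 : Continuous h1 := continuous_iff_continuousAt.2 fun x ↦ (hh1 x).continuousAt
  have ce : Continuous e := continuous_iff_continuousAt.2 fun x ↦ (he x).continuousAt
  set B : ℝ → ℝ := fun x ↦
    h x ^ 2 * (e x ^ 2 * (cos (x - t) / sin (x - t))) - e x ^ 2 * (h x * h1 x) with hB
  set L : ℝ → ℝ := fun x ↦ h x ^ 2 * e1 x ^ 2 - 2 * g x * h x * e x ^ 2 with hL
  have cL : Continuous L := by fun_prop
  set F : ℝ → ℝ := fun x ↦ (∫ y in 0..x, L y) - B x with hF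
  have hdI : ∀ x, HasDerivAt (fun x ↦ ∫ y in 0..x, L y) (L x) x := fun x ↦
    intervalIntegral.integral_hasDerivAt_right (cL.intervalIntegrable _ _)
      cL.aestronglyMeasurable.stronglyMeasurableAtFilter cL.continuousAt
  have hs : ∀ x ∈ Icc 0 π, x ≠ t → sin (x - t) ≠ 0 := by
    intro x hx hxt
    rcases lt_or_gt_of_ne hxt with h | h
    · exact (sin_neg_of_neg_of_neg_pi_lt (by linarith) (by linarith [hx.1, ht.2])).ne
    · exact (sin_pos_of_pos_of_lt_pi (by linarith) (by linarith [hx.2, ht.1])).ne'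
  have hdF : ∀ x ∈ Icc 0 π, x ≠ t → HasDerivAt F
      ((h x * e1 x - e x * (h x * (cos (x - t) / sin (x - t)) - h1 x)) ^ 2) x := by
    intro x hx hxt
    have hsx := hs x hx hxt
    have hx1 : HasDerivAt (fun x ↦ x - t) 1 x := (hasDerivAt_id x).sub_const t
    have hd := (hdI x).sub ((((hh x).pow 2).mul (((he x).pow 2).mul (hx1.cos.div hx1.sin hsx))).sub
      (((he x).pow 2).mul ((hh x).mul (hh1 x))))
    refine hd.congr_deriv ?_
    simp only [hL, Pi.pow_apply, Pi.mul_apply, Pi.div_apply]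
    field_simp
    ring
  have cF : ContinuousOn F (Icc 0 π) := by
    intro x hx
    by_cases hxt : x = t
    · subst hxt
      exact ((hdI x).continuousAt.sub ((ch.continuousAt.pow 2 |>.mul
        (continuousAt_sq_mul_cot (he x) het)).sub (by fun_prop))).continuousWithinAt
    · exact (hdF x hx hxt).continuousAt.continuousWithinAt
  have m1 : F 0 ≤ F t := by
    refine monotoneOn_of_deriv_nonneg (convex_Icc 0 t)
      (cF.mono (Icc_subset_Icc_right ht.2.le)) ?_ ?_ (left_mem_Icc.2 ht.1.le)
      (right_mem_Icc.2 ht.1.le) ht.1.le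
    · rw [interior_Icc]
      exact fun x hx ↦ (hdF x ⟨hx.1.le, (hx.2.trans ht.2).le⟩
        hx.2.ne).differentiableAt.differentiableWithinAt
    · rw [interior_Icc]
      intro x hx
      rw [(hdF x ⟨hx.1.le, (hx.2.trans ht.2).le⟩ hx.2.ne).deriv]
      positivity
  have m2 : F t ≤ F π := by
    refine monotoneOn_of_deriv_nonneg (convex_Icc t π)
      (cF.mono (Icc_subset_Icc_left ht.1.le)) ?_ ?_ (left_mem_Icc.2 ht.2.le)
      (right_mem_Icc.2 ht.2.le) ht.2.le
    · rw [interior_Icc]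
      exact fun x hx ↦ (hdF x ⟨(ht.1.trans hx.1).le, hx.2.le⟩
        hx.1.ne').differentiableAt.differentiableWithinAt
    · rw [interior_Icc]
      intro x hx
      rw [(hdF x ⟨(ht.1.trans hx.1).le, hx.2.le⟩ hx.1.ne').deriv]
      positivity
  have hBB : B π = B 0 := by
    simp only [hB, hper, hhper, hh1per, sin_pi_sub, cos_pi_sub, zero_sub, sin_neg, cos_neg,
      neg_div, div_neg]
  have hmain : 0 ≤ ∫ y in 0..π, L y := by
    have := m1.trans m2
    simp only [hF, hBB, intervalIntegral.integral_same] at this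
    linarith
  rw [hL, intervalIntegral.integral_sub (Continuous.intervalIntegrable (by fun_prop) _ _)
    (Continuous.intervalIntegrable (by fun_prop) _ _)] at hmain
  linarith

/-- The support function of the planar zonoid with generating density `g` on `[0, π]`. -/
noncomputable def sineTransform (g : ℝ → ℝ) (x : ℝ) : ℝ := ∫ y in 0..π, |sin (x - y)| * g y

lemma continuous_sineTransform {g : ℝ → ℝ} (hg : Continuous g) : Continuous (sineTransform g) :=
  intervalIntegral.continuous_parametric_intervalIntegral_of_continuous' (by fun_prop) 0 π

lemma sineTransform_pos {g : ℝ → ℝ} (hg : Continuous g) (hpos : ∀ x, 0 < g x) (x : ℝ) :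
    0 < sineTransform g x := by
  have hc : Continuous fun y ↦ |sin (x - y)| * g y := by fun_prop
  obtain ⟨c, hc1, hc2⟩ : ∃ c ∈ Icc (0 : ℝ) π, 0 < |sin (x - c)| * g c := by
    by_cases h : sin x = 0
    · refine ⟨π / 2, ⟨by positivity, by linarith [pi_pos]⟩, mul_pos (abs_pos.2 ?_) (hpos _)⟩
      rw [sin_sub_pi_div_two]
      intro h'
      have := sin_sq_add_cos_sq x
      rw [h, neg_eq_zero.1 h'] at this
      norm_num at this
    · exact ⟨0, ⟨le_rfl, pi_pos.le⟩, mul_pos (abs_pos.2 (by simpa using h)) (hpos _)⟩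
  exact intervalIntegral.integral_pos pi_pos hc.continuousOn
    (fun y _ ↦ mul_nonneg (abs_nonneg _) (hpos y).le) ⟨c, hc1, hc2⟩

lemma sineTransform_eq {g : ℝ → ℝ} (hg : Continuous g) {x : ℝ} (hx : x ∈ Icc 0 π) :
    sineTransform g x =
      sin x * (2 * (∫ y in 0..x, cos y * g y) - ∫ y in 0..π, cos y * g y) -
      cos x * (2 * (∫ y in 0..x, sin y * g y) - ∫ y in 0..π, sin y * g y) := by
  have hi : ∀ {k : ℝ → ℝ} (_ : Continuous k) (a b : ℝ), IntervalIntegrable k volume a b :=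
    fun hk a b ↦ hk.intervalIntegrable a b
  have cc : Continuous fun y ↦ cos y * g y := by fun_prop
  have cs : Continuous fun y ↦ sin y * g y := by fun_prop
  have ca : Continuous fun y ↦ |sin (x - y)| * g y := by fun_prop
  have e1 : ∫ y in 0..x, |sin (x - y)| * g y =
      ∫ y in 0..x, (sin x * (cos y * g y) - cos x * (sin y * g y)) := by
    refine intervalIntegral.integral_congr fun y hy ↦ ?_
    rw [uIcc_of_le hx.1] at hy
    rw [abs_of_nonneg (sin_nonneg_of_nonneg_of_le_pi (by linarith [hy.2])
      (by linarith [hy.1, hx.2])), sin_sub]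
    ring
  have e2 : ∫ y in x..π, |sin (x - y)| * g y =
      ∫ y in x..π, (cos x * (sin y * g y) - sin x * (cos y * g y)) := by
    refine intervalIntegral.integral_congr fun y hy ↦ ?_
    rw [uIcc_of_le hx.2] at hy
    rw [abs_of_nonpos (sin_nonpos_of_nonpos_of_neg_pi_le (by linarith [hy.1])
      (by linarith [hy.2, hx.1])), sin_sub]
    ring
  rw [sineTransform, ← intervalIntegral.integral_add_adjacent_intervals (hi ca 0 x) (hi ca x π),
    e1, e2, intervalIntegral.integral_sub (hi (by fun_prop) _ _) (hi (by fun_prop) _ _),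
    intervalIntegral.integral_sub (hi (by fun_prop) _ _) (hi (by fun_prop) _ _)]
  simp only [intervalIntegral.integral_const_mul]
  rw [← intervalIntegral.integral_add_adjacent_intervals (hi cc 0 x) (hi cc x π),
    ← intervalIntegral.integral_add_adjacent_intervals (hi cs 0 x) (hi cs x π)]
  ring

/-- The planar Blaschke–Santaló inequality for a symmetric body with curvature radius `g`. -/
lemma integral_mul_sineTransform_mul_le {g : ℝ → ℝ} (hg : Continuous g) (hpos : ∀ x, 0 < g x) :
    (∫ x in 0..π, g x * sineTransform g x) * (∫ x in 0..π, (sineTransform g x ^ 2)⁻¹)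
      ≤ π ^ 2 / 2 := by
  set k := sineTransform g with hk
  have ck : Continuous k := continuous_sineTransform hg
  have kpos := sineTransform_pos hg hpos
  have cr : Continuous fun x ↦ (k x ^ 2)⁻¹ := (ck.pow 2).inv₀ fun x ↦ (pow_pos (kpos x) 2).ne'
  have ftc : ∀ {u : ℝ → ℝ} (_ : Continuous u) (x : ℝ),
      HasDerivAt (fun x ↦ ∫ y in 0..x, u y) (u x) x := fun hu x ↦
    intervalIntegral.integral_hasDerivAt_right (hu.intervalIntegrable _ _)
      hu.aestronglyMeasurable.stronglyMeasurableAtFilter hu.continuousAt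
  have cc : Continuous fun y ↦ cos y * g y := by fun_prop
  have cs : Continuous fun y ↦ sin y * g y := by fun_prop
  set P := ∫ y in 0..π, cos y * g y with hP
  set Q := ∫ y in 0..π, sin y * g y with hQ
  set h : ℝ → ℝ := fun x ↦ sin x * (2 * (∫ y in 0..x, cos y * g y) - P) -
      cos x * (2 * (∫ y in 0..x, sin y * g y) - Q) with hh
  set h1 : ℝ → ℝ := fun x ↦ cos x * (2 * (∫ y in 0..x, cos y * g y) - P) +
      sin x * (2 * (∫ y in 0..x, sin y * g y) - Q) with hh1
  have hkh : ∀ x ∈ Icc 0 π, k x = h x := fun x hx ↦ sineTransform_eq hg hx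
  have dh : ∀ x, HasDerivAt h (h1 x) x := by
    intro x
    refine (((hasDerivAt_sin x).mul (((ftc cc x).const_mul 2).sub_const P)).sub
      ((hasDerivAt_cos x).mul (((ftc cs x).const_mul 2).sub_const Q))).congr_deriv ?_
    simp only [hh1]
    ring
  have dh1 : ∀ x, HasDerivAt h1 (2 * g x - h x) x := by
    intro x
    refine (((hasDerivAt_cos x).mul (((ftc cc x).const_mul 2).sub_const P)).add
      ((hasDerivAt_sin x).mul (((ftc cs x).const_mul 2).sub_const Q))).congr_deriv ?_
    simp only [hh]
    linear_combination (2 * g x) * sin_sq_add_cos_sq x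
  have hper : h π = h 0 := by simp [hh, ← hP, ← hQ]; ring
  have hper1 : h1 π = h1 0 := by simp [hh1, ← hP, ← hQ]; ring
  set τ : ℝ → ℝ := fun x ↦ ∫ y in 0..x, (k y ^ 2)⁻¹ with hτ
  have dτ : ∀ x, HasDerivAt τ ((k x ^ 2)⁻¹) x := ftc cr
  have cτ : Continuous τ := continuous_iff_continuousAt.2 fun x ↦ (dτ x).continuousAt
  set T := ∫ x in 0..π, (k x ^ 2)⁻¹ with hT
  have τ0 : τ 0 = 0 := by simp [hτ]
  have τπ : τ π = T := rfl
  have Tpos : 0 < T := intervalIntegral.intervalIntegral_pos_of_pos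
    (cr.intervalIntegrable _ _) (fun x ↦ inv_pos.2 (pow_pos (kpos x) 2)) pi_pos
  have key : ∀ a ∈ Ioo (0 : ℝ) 1, ∫ x in 0..π, 2 * g x * h x * sin (π / T * τ x - π * a) ^ 2 ≤
      ∫ x in 0..π, h x ^ 2 * (cos (π / T * τ x - π * a) * (π / T * (k x ^ 2)⁻¹)) ^ 2 := by
    intro a ha
    obtain ⟨t, ht, hta⟩ : ∃ t ∈ Ioo 0 π, τ t = a * T := by
      have := intermediate_value_Ioo pi_pos.le cτ.continuousOn
      rw [τ0, τπ] at this
      exact this ⟨mul_pos ha.1 Tpos, by nlinarith [ha.2]⟩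
    refine integral_curvature_mul_sq_le ht hg dh dh1
      (fun x ↦ (((dτ x).const_mul (π / T)).sub_const (π * a)).sin) (by fun_prop) ?_ ?_ hper hper1
    · rw [hta, show π / T * (a * T) - π * a = 0 by field_simp; ring, sin_zero]
    · rw [τπ, τ0, div_mul_cancel₀ _ Tpos.ne', mul_zero, zero_sub, sin_pi_sub, sin_neg, neg_sq]
  have ch : Continuous h := continuous_iff_continuousAt.2 fun x ↦ (dh x).continuousAt
  have k1 := key (1 / 4) (by norm_num)
  have k2 := key (3 / 4) (by norm_num)
  have hsum := add_le_add k1 k2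
  rw [← intervalIntegral.integral_add (Continuous.intervalIntegrable (by fun_prop) _ _)
      (Continuous.intervalIntegrable (by fun_prop) _ _),
    ← intervalIntegral.integral_add (Continuous.intervalIntegrable (by fun_prop) _ _)
      (Continuous.intervalIntegrable (by fun_prop) _ _)] at hsum
  have hshift : ∀ x, π / T * τ x - π * (1 / 4) = (π / T * τ x - π * (3 / 4)) + π / 2 :=
    fun x ↦ by ring
  have l : ∫ x in 0..π, (2 * g x * h x * sin (π / T * τ x - π * (1 / 4)) ^ 2 +
      2 * g x * h x * sin (π / T * τ x - π * (3 / 4)) ^ 2) = 2 * ∫ x in 0..π, g x * k x := by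
    rw [← intervalIntegral.integral_const_mul]
    refine intervalIntegral.integral_congr fun x hx ↦ ?_
    rw [uIcc_of_le pi_pos.le] at hx
    simp only [hshift, sin_add_pi_div_two, hkh x hx]
    linear_combination (2 * g x * h x) * sin_sq_add_cos_sq (π / T * τ x - π * (3 / 4))
  have r : ∫ x in 0..π, (h x ^ 2 * (cos (π / T * τ x - π * (1 / 4)) * (π / T * (k x ^ 2)⁻¹)) ^ 2 +
      h x ^ 2 * (cos (π / T * τ x - π * (3 / 4)) * (π / T * (k x ^ 2)⁻¹)) ^ 2) =
      (π / T) ^ 2 * T := by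
    rw [hT, ← intervalIntegral.integral_const_mul, ← hT]
    refine intervalIntegral.integral_congr fun x hx ↦ ?_
    rw [uIcc_of_le pi_pos.le] at hx
    simp only [hshift, cos_add_pi_div_two, ← hkh x hx]
    have := (kpos x).ne'
    rw [← hk] at this
    have hc := sin_sq_add_cos_sq (π / T * τ x - π * (3 / 4))
    generalize π / T * τ x - π * (3 / 4) = z at hc ⊢
    field_simp
    linear_combination hc
  rw [l, r, show (π / T) ^ 2 * T = π ^ 2 / T by field_simp, le_div_iff₀ Tpos] at hsum
  linarith

lemma lintegral_ofReal_Ico {u : ℝ → ℝ} (hu : Continuous u) (h0 : ∀ x, 0 ≤ u x) {b : ℝ}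
    (hb : 0 ≤ b) :
    ∫⁻ x in Ico 0 b, ENNReal.ofReal (u x) = ENNReal.ofReal (∫ x in 0..b, u x) := by
  rw [intervalIntegral.integral_of_le hb, restrict_Ico_eq_restrict_Ioc,
    ofReal_integral_eq_lintegral_ofReal
      ((hu.intervalIntegrable 0 b).1) (Filter.Eventually.of_forall h0)]

lemma integral_zero_two_pi_eq_fold {u : ℝ → ℝ} (hu : Continuous u) :
    ∫ x in 0..(2 * π), u x = ∫ x in 0..π, (u x + u (x + π)) := by
  rw [intervalIntegral.integral_add (hu.intervalIntegrable _ _)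
      (Continuous.intervalIntegrable (by fun_prop) _ _),
    intervalIntegral.integral_comp_add_right, zero_add, ← two_mul,
    intervalIntegral.integral_add_adjacent_intervals (hu.intervalIntegrable _ _)
      (hu.intervalIntegrable _ _)]

lemma sineTransform_add_pi (g : ℝ → ℝ) (x : ℝ) :
    sineTransform g (x + π) = sineTransform g x := by
  simp only [sineTransform, show ∀ y, x + π - y = x - y + π from fun y ↦ by ring, sin_add_pi,
    abs_neg]

lemma busemann_circle_of_continuous {f : ℝ → ℝ} (hf : Continuous f) (hpos : ∀ x, 0 < f x) :
    (∫⁻ θ in Ico 0 (2 * π), ENNReal.ofReal (f θ) ^ ((2 : ℝ) / 3)) ≤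
      (ENNReal.ofReal (π ^ 2) * ∫⁻ θ in Ico 0 (2 * π), ∫⁻ φ in Ico 0 (2 * π),
          ENNReal.ofReal (f θ * f φ * |sin (θ - φ)|)) ^ ((1 : ℝ) / 3) := by
  set g : ℝ → ℝ := fun x ↦ f x + f (x + π) with hgdef
  have cg : Continuous g := by fun_prop
  have gpos : ∀ x, 0 < g x := fun x ↦ add_pos (hpos _) (hpos _)
  set k := sineTransform g with hk
  have ck : Continuous k := continuous_sineTransform cg
  have kpos : ∀ x, 0 < k x := sineTransform_pos cg gpos
  have cr : Continuous fun x ↦ (k x ^ 2)⁻¹ := (ck.pow 2).inv₀ fun x ↦ (pow_pos (kpos x) 2).ne'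
  have kper : ∀ x, k (x + π) = k x := sineTransform_add_pi g
  have h2π : 0 ≤ 2 * π := by positivity
  have inner : ∀ θ, ∫⁻ φ in Ico 0 (2 * π), ENNReal.ofReal (f θ * f φ * |sin (θ - φ)|) =
      ENNReal.ofReal (f θ * k θ) := by
    intro θ
    rw [lintegral_ofReal_Ico (by fun_prop)
      (fun φ ↦ mul_nonneg (mul_pos (hpos _) (hpos _)).le (abs_nonneg _)) h2π,
      integral_zero_two_pi_eq_fold (by fun_prop), hk, sineTransform,
      ← intervalIntegral.integral_const_mul]
    congr 1
    refine intervalIntegral.integral_congr fun φ _ ↦ ?_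
    simp only [hgdef, show θ - (φ + π) = θ - φ - π by ring, sin_sub_pi, abs_neg]
    ring
  simp only [inner]
  have fk0 : ∀ x, 0 ≤ f x * k x := fun x ↦ (mul_pos (hpos x) (kpos x)).le
  have r0 : ∀ x, 0 ≤ (k x ^ 2)⁻¹ := fun x ↦ (inv_pos.2 (pow_pos (kpos x) 2)).le
  have hprod : (∫⁻ x in Ico 0 (2 * π), ENNReal.ofReal (f x * k x)) *
      (∫⁻ x in Ico 0 (2 * π), ENNReal.ofReal ((k x ^ 2)⁻¹)) ≤ ENNReal.ofReal (π ^ 2) := by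
    rw [lintegral_ofReal_Ico (by fun_prop) fk0 h2π, lintegral_ofReal_Ico cr r0 h2π,
      ← ENNReal.ofReal_mul (intervalIntegral.integral_nonneg h2π fun x _ ↦ fk0 x)]
    refine ENNReal.ofReal_le_ofReal ?_
    rw [integral_zero_two_pi_eq_fold (by fun_prop), integral_zero_two_pi_eq_fold cr]
    simp only [kper, ← add_mul, ← two_mul, intervalIntegral.integral_const_mul]
    linarith [integral_mul_sineTransform_mul_le cg gpos]
  set A := ∫⁻ x in Ico 0 (2 * π), ENNReal.ofReal (f x * k x)
  set P := ∫⁻ x in Ico 0 (2 * π), ENNReal.ofReal ((k x ^ 2)⁻¹)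
  have hpt : ∀ x, ENNReal.ofReal (f x) ^ ((2 : ℝ) / 3) =
      ENNReal.ofReal (f x * k x) ^ ((2 : ℝ) / 3) *
        ENNReal.ofReal ((k x ^ 2)⁻¹) ^ ((1 : ℝ) / 3) := by
    intro x
    rw [ENNReal.ofReal_rpow_of_nonneg (hpos x).le (by norm_num),
      ENNReal.ofReal_rpow_of_nonneg (fk0 x) (by norm_num),
      ENNReal.ofReal_rpow_of_nonneg (r0 x) (by norm_num), ← ENNReal.ofReal_mul (rpow_nonneg (fk0 x) _),
      mul_rpow (hpos x).le (kpos x).le, inv_rpow (by positivity), ← rpow_natCast (k x) 2,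
      ← rpow_mul (kpos x).le, mul_assoc]
    norm_num
    rw [mul_inv_cancel₀ (rpow_pos_of_pos (kpos x) _).ne', mul_one]
  calc ∫⁻ θ in Ico 0 (2 * π), ENNReal.ofReal (f θ) ^ ((2 : ℝ) / 3)
      ≤ A ^ ((2 : ℝ) / 3) * P ^ ((1 : ℝ) / 3) := by
        simp only [hpt]
        exact ENNReal.lintegral_mul_norm_pow_le (by fun_prop) (by fun_prop) (by norm_num)
          (by norm_num) (by norm_num)
    _ = (A * P * A) ^ ((1 : ℝ) / 3) := by
        rw [show (2 : ℝ) / 3 = 1 / 3 + 1 / 3 by norm_num,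
          ENNReal.rpow_add_of_nonneg _ _ (by norm_num) (by norm_num),
          ENNReal.mul_rpow_of_nonneg _ _ (by norm_num), ENNReal.mul_rpow_of_nonneg _ _ (by norm_num)]
        ring
    _ ≤ _ := by
        refine ENNReal.rpow_le_rpow ?_ (by norm_num)
        gcongr

lemma busemann_circle_of_integrable {f : ℝ → ℝ} (hf : Measurable f) (hf0 : ∀ x, 0 ≤ f x)
    (hint : IntegrableOn f (Ico 0 (2 * π))) :
    (∫⁻ θ in Ico 0 (2 * π), ENNReal.ofReal (f θ) ^ ((2 : ℝ) / 3)) ≤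
      (ENNReal.ofReal (π ^ 2) * ∫⁻ θ in Ico 0 (2 * π), ∫⁻ φ in Ico 0 (2 * π),
          ENNReal.ofReal (f θ * f φ * |sin (θ - φ)|)) ^ ((1 : ℝ) / 3) := by
  set μ : Measure ℝ := volume.restrict (Ico 0 (2 * π)) with hμ
  set E := ∫⁻ θ, ∫⁻ φ, ENNReal.ofReal (f θ * f φ * |sin (θ - φ)|) ∂μ ∂μ
  set M := ∫⁻ θ, ENNReal.ofReal (f θ) ∂μ
  have hMfin : M ≠ ∞ := hint.lintegral_lt_top.ne
  have hμuniv : μ univ ≠ ∞ := by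
    rw [hμ, Measure.restrict_apply_univ]
    exact measure_Ico_lt_top.ne
  have bound : ∀ δ : ℝ≥0∞, δ ≠ 0 → δ ≠ ∞ →
      (∫⁻ θ, ENNReal.ofReal (f θ) ^ ((2 : ℝ) / 3) ∂μ) ≤
      (ENNReal.ofReal (π ^ 2) * (E + M * (δ + μ univ * δ) + (δ + μ univ * δ) * M +
        (δ + μ univ * δ) * (δ + μ univ * δ))) ^ ((1 : ℝ) / 3) +
      (δ + μ univ * δ) ^ ((2 : ℝ) / 3) * (μ univ) ^ ((1 : ℝ) / 3) := by
    intro δ hδ hδ'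
    obtain ⟨u, hu, -⟩ := hint.exists_boundedContinuous_lintegral_sub_le hδ
    have hδr : 0 < δ.toReal := ENNReal.toReal_pos hδ hδ'
    set k : ℝ → ℝ := fun x ↦ max (u x) 0 + δ.toReal with hk
    have ck : Continuous k := by fun_prop
    have kpos : ∀ x, 0 < k x := fun x ↦ by positivity
    set D : ℝ → ℝ≥0∞ := fun x ↦ ENNReal.ofReal |f x - k x| with hD
    have mD : Measurable D := by fun_prop
    have hDle : ∫⁻ x, D x ∂μ ≤ δ + μ univ * δ := by
      calc ∫⁻ x, D x ∂μ ≤ ∫⁻ x, (‖f x - u x‖ₑ + δ) ∂μ := by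
            refine lintegral_mono fun x ↦ ?_
            rw [← ofReal_norm]
            nth_rw 1 [← ENNReal.ofReal_toReal hδ']
            rw [← ENNReal.ofReal_add (norm_nonneg _) hδr.le]
            refine ENNReal.ofReal_le_ofReal ?_
            have h1 : |f x - max (u x) 0| ≤ |f x - u x| := by
              have := abs_max_sub_max_le_abs (f x) (u x) 0
              rwa [max_eq_left (hf0 x)] at this
            have h2 := abs_sub (f x - max (u x) 0) δ.toReal
            rw [abs_of_pos hδr] at h2
            simp only [hk, Real.norm_eq_abs, ← sub_sub]
            linarith
        _ ≤ δ + μ univ * δ := by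
            rw [lintegral_add_right _ measurable_const, lintegral_const, mul_comm]
            gcongr
    have hfk : ∀ x, ENNReal.ofReal (f x) ≤ ENNReal.ofReal (k x) + D x := by
      intro x
      rw [hD, ← ENNReal.ofReal_add (kpos x).le (abs_nonneg _)]
      exact ENNReal.ofReal_le_ofReal (by linarith [le_abs_self (f x - k x)])
    have hkf : ∀ x, ENNReal.ofReal (k x) ≤ ENNReal.ofReal (f x) + D x := by
      intro x
      rw [hD, ← ENNReal.ofReal_add (hf0 x) (abs_nonneg _)]
      exact ENNReal.ofReal_le_ofReal (by linarith [neg_abs_le (f x - k x)])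
    set d := ∫⁻ x, D x ∂μ with hd
    have hDpow : ∫⁻ x, D x ^ ((2 : ℝ) / 3) ∂μ ≤ d ^ ((2 : ℝ) / 3) * (μ univ) ^ ((1 : ℝ) / 3) := by
      simpa using ENNReal.lintegral_mul_norm_pow_le (μ := μ) (f := D) (g := fun _ ↦ 1)
        mD.aemeasurable aemeasurable_const (p := 2 / 3) (q := 1 / 3) (by norm_num) (by norm_num)
        (by norm_num)
    have mf : Measurable fun x ↦ ENNReal.ofReal (f x) := by fun_prop
    have hEk : ∫⁻ θ, ∫⁻ φ, ENNReal.ofReal (k θ * k φ * |sin (θ - φ)|) ∂μ ∂μ ≤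
        E + M * d + d * M + d * d := by
      have hs : ∀ z, ENNReal.ofReal |sin z| ≤ 1 := fun z ↦
        ENNReal.ofReal_le_one.2 (abs_sin_le_one z)
      have pt : ∀ θ φ, ENNReal.ofReal (k θ * k φ * |sin (θ - φ)|) ≤
          ENNReal.ofReal (f θ * f φ * |sin (θ - φ)|) + (ENNReal.ofReal (f θ) * D φ +
            D θ * ENNReal.ofReal (f φ) + D θ * D φ) := by
        intro θ φ
        rw [ENNReal.ofReal_mul (mul_pos (kpos θ) (kpos φ)).le, ENNReal.ofReal_mul (kpos θ).le,
          ENNReal.ofReal_mul (mul_nonneg (hf0 θ) (hf0 φ)), ENNReal.ofReal_mul (hf0 θ)]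
        calc _ ≤ (ENNReal.ofReal (f θ) + D θ) * (ENNReal.ofReal (f φ) + D φ) *
              ENNReal.ofReal |sin (θ - φ)| := by gcongr <;> apply hkf
          _ = ENNReal.ofReal (f θ) * ENNReal.ofReal (f φ) * ENNReal.ofReal |sin (θ - φ)| +
              (ENNReal.ofReal (f θ) * D φ + D θ * ENNReal.ofReal (f φ) + D θ * D φ) *
                ENNReal.ofReal |sin (θ - φ)| := by ring
          _ ≤ _ := by
              gcongr
              exact mul_le_of_le_one_right' (hs _)
      calc _ ≤ ∫⁻ θ, ∫⁻ φ, (ENNReal.ofReal (f θ * f φ * |sin (θ - φ)|) +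
            (ENNReal.ofReal (f θ) * D φ + D θ * ENNReal.ofReal (f φ) + D θ * D φ)) ∂μ ∂μ :=
            lintegral_mono fun θ ↦ lintegral_mono fun φ ↦ pt θ φ
        _ = ∫⁻ θ, ((∫⁻ φ, ENNReal.ofReal (f θ * f φ * |sin (θ - φ)|) ∂μ) +
            (ENNReal.ofReal (f θ) * d + D θ * M + D θ * d)) ∂μ := by
            refine lintegral_congr fun θ ↦ ?_
            rw [lintegral_add_right _ (by fun_prop), lintegral_add_right _ (by fun_prop),
              lintegral_add_right _ (by fun_prop), lintegral_const_mul _ mD,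
              lintegral_const_mul _ mf, lintegral_const_mul _ mD]
        _ = E + M * d + d * M + d * d := by
            rw [lintegral_add_right _ (by fun_prop), lintegral_add_right _ (by fun_prop),
              lintegral_add_right _ (by fun_prop), lintegral_mul_const _ mf,
              lintegral_mul_const _ mD, lintegral_mul_const _ mD]
            ring
    calc ∫⁻ θ, ENNReal.ofReal (f θ) ^ ((2 : ℝ) / 3) ∂μ
        ≤ ∫⁻ θ, (ENNReal.ofReal (k θ) ^ ((2 : ℝ) / 3) + D θ ^ ((2 : ℝ) / 3)) ∂μ :=
          lintegral_mono fun θ ↦ (ENNReal.rpow_le_rpow (hfk θ) (by norm_num)).trans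
            (ENNReal.rpow_add_le_add_rpow _ _ (by norm_num) (by norm_num))
      _ = (∫⁻ θ, ENNReal.ofReal (k θ) ^ ((2 : ℝ) / 3) ∂μ) + ∫⁻ θ, D θ ^ ((2 : ℝ) / 3) ∂μ :=
          lintegral_add_right _ (by fun_prop)
      _ ≤ (ENNReal.ofReal (π ^ 2) * (E + M * d + d * M + d * d)) ^ ((1 : ℝ) / 3) +
          d ^ ((2 : ℝ) / 3) * (μ univ) ^ ((1 : ℝ) / 3) := by
          refine add_le_add ((busemann_circle_of_continuous ck kpos).trans ?_) hDpow
          gcongr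
      _ ≤ _ := by gcongr
  have t0 : Filter.Tendsto (fun δ : ℝ≥0∞ ↦ δ + μ univ * δ) (nhdsWithin 0 (Ioi 0)) (nhds 0) := by
    have h : Filter.Tendsto (fun δ : ℝ≥0∞ ↦ δ + μ univ * δ) (nhds 0) (nhds (0 + μ univ * 0)) :=
      Filter.tendsto_id.add (ENNReal.Tendsto.const_mul Filter.tendsto_id (Or.inr hμuniv))
    simpa using h.mono_left nhdsWithin_le_nhds
  have tlim : Filter.Tendsto (fun η : ℝ≥0∞ ↦
      (ENNReal.ofReal (π ^ 2) * (E + M * η + η * M + η * η)) ^ ((1 : ℝ) / 3) +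
        η ^ ((2 : ℝ) / 3) * (μ univ) ^ ((1 : ℝ) / 3)) (nhds 0)
      (nhds ((ENNReal.ofReal (π ^ 2) * (E + M * 0 + 0 * M + 0 * 0)) ^ ((1 : ℝ) / 3) +
        0 ^ ((2 : ℝ) / 3) * (μ univ) ^ ((1 : ℝ) / 3))) := by
    have i : Filter.Tendsto (fun η : ℝ≥0∞ ↦ η) (nhds 0) (nhds 0) := Filter.tendsto_id
    refine ((ENNReal.Tendsto.const_mul (((tendsto_const_nhds.add
      (ENNReal.Tendsto.const_mul i (Or.inr hMfin))).add
      (ENNReal.Tendsto.mul_const i (Or.inr hMfin))).add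
      (ENNReal.Tendsto.mul i (Or.inr (by simp)) i (Or.inr (by simp))))
      (Or.inr ENNReal.ofReal_ne_top)).ennrpow_const _).add
      (ENNReal.Tendsto.mul_const (i.ennrpow_const _) (Or.inr ?_))
    exact ENNReal.rpow_ne_top_of_nonneg (by norm_num) hμuniv
  have hlim := tlim.comp t0
  rw [mul_zero, zero_mul, mul_zero, add_zero, add_zero, add_zero,
    ENNReal.zero_rpow_of_pos (by norm_num), zero_mul, add_zero] at hlim
  refine ge_of_tendsto hlim ?_
  have hlt : ∀ᶠ δ : ℝ≥0∞ in nhdsWithin 0 (Ioi 0), δ < ∞ :=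
    nhdsWithin_le_nhds (Iio_mem_nhds ENNReal.zero_lt_top)
  filter_upwards [self_mem_nhdsWithin, hlt] with δ h1 h2
  exact bound δ (ne_of_gt h1) h2.ne

/-- **Busemann's inequality on the circle.**  For every measurable
`f : [0,2π) → [0,∞)`,
`∫₀^{2π}∫₀^{2π} f(θ) f(φ) |sin(θ−φ)| dθ dφ ≥ (1/π²) (∫₀^{2π} f(θ)^{2/3} dθ)³`,
both sides possibly infinite. -/
theorem busemann_circle
    (f : ℝ → ℝ) (hf : Measurable f) (hf0 : ∀ θ, 0 ≤ f θ) :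
    ENNReal.ofReal (1 / π ^ 2) *
        (∫⁻ θ in Set.Ico 0 (2 * π), ENNReal.ofReal ((f θ) ^ ((2 : ℝ) / 3))) ^ 3
      ≤ ∫⁻ θ in Set.Ico 0 (2 * π), ∫⁻ φ in Set.Ico 0 (2 * π),
          ENNReal.ofReal (f θ * f φ * |Real.sin (θ - φ)|) := by
  set E := ∫⁻ θ in Set.Ico 0 (2 * π), ∫⁻ φ in Set.Ico 0 (2 * π),
          ENNReal.ofReal (f θ * f φ * |Real.sin (θ - φ)|)
  have trunc : ∀ n : ℕ, ∫⁻ θ in Ico 0 (2 * π), ENNReal.ofReal (min (f θ) n) ^ ((2 : ℝ) / 3) ≤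
      (ENNReal.ofReal (π ^ 2) * E) ^ ((1 : ℝ) / 3) := by
    intro n
    have h0 : ∀ x, 0 ≤ min (f x) n := fun x ↦ le_min (hf0 x) n.cast_nonneg
    have mn : Measurable fun x ↦ min (f x) n := hf.min measurable_const
    refine (busemann_circle_of_integrable mn h0 ?_).trans ?_
    · refine Measure.integrableOn_of_bounded (M := n) measure_Ico_lt_top.ne mn.aestronglyMeasurable ?_
      refine Filter.Eventually.of_forall fun x ↦ ?_
      rw [Real.norm_eq_abs, abs_of_nonneg (h0 x)]
      exact min_le_right _ _
    · gcongr
      refine lintegral_mono fun θ ↦ lintegral_mono fun φ ↦ ENNReal.ofReal_le_ofReal ?_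
      have := h0 φ
      have := hf0 θ
      gcongr <;> exact min_le_left _ _
  have lim : ∫⁻ θ in Ico 0 (2 * π), ENNReal.ofReal ((f θ) ^ ((2 : ℝ) / 3)) ≤
      (ENNReal.ofReal (π ^ 2) * E) ^ ((1 : ℝ) / 3) := by
    refine le_of_tendsto' (lintegral_tendsto_of_tendsto_of_monotone
      (f := fun (n : ℕ) θ ↦ ENNReal.ofReal (min (f θ) n) ^ ((2 : ℝ) / 3))
      (fun n ↦ by fun_prop) ?_ ?_) trunc
    · refine Filter.Eventually.of_forall fun θ m n hmn ↦ ?_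
      dsimp only
      gcongr
    · refine Filter.Eventually.of_forall fun θ ↦ tendsto_const_nhds.congr' ?_
      filter_upwards [Filter.eventually_ge_atTop ⌈f θ⌉₊] with n hn
      rw [min_eq_left (Nat.ceil_le.1 hn), ENNReal.ofReal_rpow_of_nonneg (hf0 θ) (by norm_num)]
  calc _ ≤ ENNReal.ofReal (1 / π ^ 2) * ((ENNReal.ofReal (π ^ 2) * E) ^ ((1 : ℝ) / 3)) ^ 3 := by
        gcongr
    _ = E := by
        rw [← ENNReal.rpow_natCast, ← ENNReal.rpow_mul]
        norm_num
        rw [← mul_assoc, ← ENNReal.ofReal_mul (by positivity),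
          inv_mul_cancel₀ (by positivity), ENNReal.ofReal_one, one_mul]
end
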